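/- arXiv:1806.11054 — 2 statements merged into one kernel-verified Lean document; each statement's English description precedes it below -/
import Mathlib

section
/- Let K be an algebraically closed field of characteristic 0, let n ≥ 1, and let M be an n×n integer matrix with det M ≠ 0 (so that the endomorphism Φ_M of the torus G = (Kˣ)^n is dominant). Then there is no proper Zariski-closed subset Y of G that intersects the forward orbit under Φ_M of every torsion point of G that is periodic under Φ_M. Equivalently: for every Zariski-closed subset Y ⊊ G there exists a torsion point x ∈ G with Φ_M^N(x) = x for some N ≥ 1 such that Φ_M^k(x) ∉ Y for every k ≥ 0. (This is Theorem 1.2 of the paper in the case where the semiabelian variety is the algebraic torus G_m^n, proved as the toric case of Theorem 2.6.) -/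
/-- The group endomorphism of the torus `(Kˣ)^ι` associated to an integer matrix `M`,
given by `(Φ_M x) i = ∏ j, (x j) ^ (M i j)`. -/
def torusEndo {K : Type*} [Field K] {ι : Type*} [Fintype ι]
    (M : Matrix ι ι ℤ) (x : ι → Kˣ) : ι → Kˣ :=
  fun i => ∏ j, x j ^ M i j

/-- A subset of the torus `(Kˣ)^ι` is Zariski closed if it is the common zero locus,
inside the torus, of a set of polynomials in the coordinates. -/
def IsZariskiClosed {K : Type*} [Field K] {ι : Type*} [Fintype ι]
    (Y : Set (ι → Kˣ)) : Prop :=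
  ∃ S : Set (MvPolynomial ι K),
    Y = {x | ∀ f ∈ S, MvPolynomial.eval (fun i => (x i : K)) f = 0}

open Filter Topology

lemma aux_descend {K : Type*} [Field K] [CharZero K] {n : ℕ}
    (f : MvPolynomial (Fin n) K) (hf : f ≠ 0) :
    ∃ g : MvPolynomial (Fin n) ℚ, g ≠ 0 ∧ ∀ x : Fin n → Kˣ,
      (∃ m : ℕ, 1 ≤ m ∧ x ^ m = 1) → MvPolynomial.eval (fun i => (x i : K)) f = 0 →
      MvPolynomial.aeval (fun i => (x i : K)) g = 0 := by
  classical
  let E := algebraicClosure ℚ K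
  obtain ⟨α, hα⟩ : ∃ α, f.coeff α ≠ 0 := by
    by_contra! h
    exact hf (MvPolynomial.ext _ _ (by simpa using h))
  obtain ⟨l, hl⟩ := Module.Projective.exists_dual_ne_zero E hα
  let f₁ : MvPolynomial (Fin n) E := ∑ β ∈ f.support, MvPolynomial.monomial β (l (f.coeff β))
  have hf₁ : f₁ ≠ 0 := by
    intro h
    apply hl
    have := congrArg (MvPolynomial.coeff α) h
    simp only [f₁, MvPolynomial.coeff_sum, MvPolynomial.coeff_monomial, Finset.sum_ite_eq',
      MvPolynomial.mem_support_iff, MvPolynomial.coeff_zero] at this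
    simpa [hα] using this
  have hEalg : Algebra.IsAlgebraic ℚ E := algebraicClosure.isAlgebraic ℚ K
  obtain ⟨g, hg, hdvd⟩ := MvPolynomial.exists_dvd_map_of_isAlgebraic (R := ℚ) hf₁
  refine ⟨g, hg, ?_⟩
  rintro x ⟨m, hm, hx⟩ h0
  have hmem : ∀ i, (x i : K) ∈ E := by
    intro i
    have h1 : (x i : K) ^ m = 1 := by
      have := congrFun hx i
      simpa using congrArg (Units.val) this
    refine (mem_algebraicClosure_iff).2 (IsIntegral.isAlgebraic ?_)
    exact IsIntegral.of_pow (by omega) (h1 ▸ isIntegral_one)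
  let y : Fin n → E := fun i => ⟨x i, hmem i⟩
  have h1 : MvPolynomial.eval y f₁ = 0 := by
    have : l (MvPolynomial.eval (fun i => (x i : K)) f) = MvPolynomial.eval y f₁ := by
      rw [MvPolynomial.eval_eq']
      simp only [f₁, map_sum, MvPolynomial.eval_monomial]
      refine Finset.sum_congr rfl fun β _ => ?_
      have e : MvPolynomial.coeff β f * ∏ i, (x i : K) ^ β i
          = (∏ i, y i ^ β i) • MvPolynomial.coeff β f := by
        rw [Algebra.smul_def, mul_comm]
        congr 1
        rw [map_prod]
        simp only [map_pow]
        rfl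
      rw [e, map_smul, smul_eq_mul, mul_comm, Finsupp.prod_fintype _ _ (by simp)]
    rw [← this, h0, map_zero]
  obtain ⟨q, hq⟩ := hdvd
  have h2 : MvPolynomial.aeval y g = (0 : E) := by
    have := congrArg (MvPolynomial.eval y) hq
    rw [map_mul, h1, zero_mul] at this
    rw [← this, MvPolynomial.eval_map, MvPolynomial.aeval_def]
  have h3 := congrArg (algebraMap E K) h2
  rw [map_zero, ← MvPolynomial.aeval_algebraMap_apply] at h3
  exact h3

lemma aux_circle {n : ℕ} (g : MvPolynomial (Fin n) ℚ) (hg : g ≠ 0) :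
    ∃ y : Fin n → ℝ, (∀ i, 0 ≤ y i) ∧
      MvPolynomial.aeval (fun i => Complex.exp (2 * Real.pi * Complex.I * (y i : ℂ))) g ≠ 0 := by
  by_contra! h
  let S : Set ℂ := {z | ∃ t : ℝ, 0 ≤ t ∧ z = Complex.exp (2 * Real.pi * Complex.I * (t : ℂ))}
  have hS : S.Infinite := by
    have h1 : (Set.Icc (0:ℝ) Real.pi).Infinite := Set.Icc_infinite Real.pi_pos
    have hi : Set.InjOn (fun t : ℝ => Complex.exp ((t : ℂ) * Complex.I)) (Set.Icc 0 Real.pi) := by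
      intro a ha b hb hab
      have := congrArg Complex.re hab
      simp only [Complex.exp_ofReal_mul_I_re] at this
      exact Real.injOn_cos ha hb this
    refine (h1.image hi).mono ?_
    rintro _ ⟨t, ht, rfl⟩
    refine ⟨t / (2 * Real.pi), div_nonneg ht.1 (by positivity), ?_⟩
    have : (Real.pi : ℂ) ≠ 0 := by exact_mod_cast Real.pi_ne_zero
    push_cast
    field_simp
  apply hg
  apply MvPolynomial.map_injective (algebraMap ℚ ℂ) (algebraMap ℚ ℂ).injective
  refine MvPolynomial.funext_set (fun _ => S) (fun _ => hS) ?_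
  intro x hx
  have hx' : ∀ i, x i ∈ S := fun i => hx i trivial
  choose t ht hxt using hx'
  have := h t ht
  rw [map_zero, map_zero, MvPolynomial.eval_map]
  rw [MvPolynomial.aeval_def] at this
  rw [← this]
  congr 1
  funext i
  exact hxt i

lemma aux_main {n : ℕ} (M : Matrix (Fin n) (Fin n) ℤ) (hM : M.det ≠ 0)
    (g : MvPolynomial (Fin n) ℚ) (hg : g ≠ 0) :
    ∃ (c m : ℕ) (a v : Fin n → ℤ), 0 < m ∧ c.Coprime m ∧
      (M.mulVec a = (c : ℤ) • a - (m : ℤ) • v) ∧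
      MvPolynomial.aeval
        (fun i => Complex.exp (2 * Real.pi * Complex.I * (((a i : ℝ) / (m : ℝ) : ℝ) : ℂ))) g ≠ 0 := by
  classical
  obtain ⟨y₀, hy₀, hne⟩ := aux_circle g hg
  let R : Matrix (Fin n) (Fin n) ℝ := M.map (Int.cast : ℤ → ℝ)
  let B : ℝ → Matrix (Fin n) (Fin n) ℝ := fun s => 1 - s • R
  have hB : Continuous B := by fun_prop
  have hB0 : B 0 = 1 := by simp [B]
  let c : ℕ → ℕ := fun k => 1 + k * M.det.natAbs
  have hcpos : ∀ k, 0 < c k := fun k => by simp only [c]; omega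
  have hc : Tendsto (fun k => ((c k : ℕ) : ℝ)) atTop atTop := by
    refine tendsto_natCast_atTop_atTop.comp ?_
    refine tendsto_atTop_mono (fun k => ?_) tendsto_id
    have : 0 < M.det.natAbs := Int.natAbs_pos.2 hM
    simp only [c, id]
    nlinarith
  have hs : Tendsto (fun k => ((c k : ℕ) : ℝ)⁻¹) atTop (𝓝 0) := tendsto_inv_atTop_zero.comp hc
  let w : ℕ → Fin n → ℝ := fun k i => (⌊y₀ i * (c k : ℝ)⌋₊ : ℝ) / (c k : ℝ)
  have hw : Tendsto w atTop (𝓝 y₀) := by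
    rw [tendsto_pi_nhds]
    intro i
    exact (tendsto_nat_floor_mul_div_atTop (hy₀ i)).comp hc
  have hdet : Tendsto (fun k => (B ((c k : ℝ)⁻¹)).det) atTop (𝓝 1) := by
    have h1 : Tendsto (fun s => (B s).det) (𝓝 0) (𝓝 1) := by
      have := (hB.matrix_det).tendsto 0
      simpa [hB0] using this
    exact h1.comp hs
  have hadj : Tendsto (fun k => (B ((c k : ℝ)⁻¹)).adjugate) atTop (𝓝 1) := by
    have h1 : Tendsto (fun s => (B s).adjugate) (𝓝 0) (𝓝 1) := by
      have := (hB.matrix_adjugate).tendsto 0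
      simpa [hB0] using this
    exact h1.comp hs
  let y : ℕ → Fin n → ℝ := fun k =>
    ((B ((c k : ℝ)⁻¹)).det)⁻¹ • (B ((c k : ℝ)⁻¹)).adjugate.mulVec (w k)
  have hy : Tendsto y atTop (𝓝 y₀) := by
    have h1 : Tendsto (fun k => (B ((c k : ℝ)⁻¹)).adjugate.mulVec (w k)) atTop (𝓝 y₀) := by
      have hcont : Continuous (fun p : Matrix (Fin n) (Fin n) ℝ × (Fin n → ℝ) => p.1.mulVec p.2) :=
        Continuous.matrix_mulVec continuous_fst continuous_snd
      have := (hcont.tendsto (1, y₀)).comp (hadj.prodMk_nhds hw)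
      simpa [Function.comp_def] using this
    have h2 := (hdet.inv₀ one_ne_zero).smul h1
    simpa using h2
  have hgc : Continuous (fun y : Fin n → ℝ => MvPolynomial.aeval
      (fun i => Complex.exp (2 * Real.pi * Complex.I * (y i : ℂ))) g) := by
    simp only [MvPolynomial.aeval_def, MvPolynomial.eval₂_eq]
    fun_prop
  have ev1 : ∀ᶠ k in atTop, MvPolynomial.aeval
      (fun i => Complex.exp (2 * Real.pi * Complex.I * (y k i : ℂ))) g ≠ 0 :=
    ((hgc.tendsto y₀).comp hy).eventually_ne hne
  have ev2 : ∀ᶠ k in atTop, 0 < (B ((c k : ℝ)⁻¹)).det :=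
    hdet.eventually (lt_mem_nhds one_pos)
  obtain ⟨k, hk1, hk2⟩ := (ev1.and ev2).exists
  let A : Matrix (Fin n) (Fin n) ℤ := Matrix.scalar (Fin n) (c k : ℤ) - M
  let v : Fin n → ℤ := fun i => (⌊y₀ i * (c k : ℝ)⌋₊ : ℤ)
  let a : Fin n → ℤ := A.adjugate.mulVec v
  have hcR : (0:ℝ) < c k := by exact_mod_cast hcpos k
  have hAR : A.map (Int.cast : ℤ → ℝ) = (c k : ℝ) • B ((c k : ℝ)⁻¹) := by
    have hAij : ∀ i j, A i j = (if i = j then (c k : ℤ) else 0) - M i j := by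
      intro i j
      change ((Matrix.diagonal (fun _ => (c k : ℤ)) : Matrix (Fin n) (Fin n) ℤ) - M) i j = _
      rw [Matrix.sub_apply, Matrix.diagonal_apply]
    ext i j
    rw [Matrix.map_apply, hAij]
    by_cases hij : i = j
    · subst hij
      simp [B, R]
      field_simp
    · simp [B, R, hij]
      field_simp
  have hAdet : ((A.det : ℤ) : ℝ) = (c k : ℝ) ^ n * (B ((c k : ℝ)⁻¹)).det := by
    have h1 : ((A.det : ℤ) : ℝ) = (A.map (Int.cast : ℤ → ℝ)).det :=
      Int.cast_det A
    rw [h1, hAR, Matrix.det_smul, Fintype.card_fin]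
  have hApos : 0 < A.det := by
    have : (0:ℝ) < ((A.det : ℤ) : ℝ) := by rw [hAdet]; positivity
    exact_mod_cast this
  obtain ⟨m, hm⟩ := Int.eq_ofNat_of_zero_le hApos.le
  have hmpos : 0 < m := by omega
  have hAa : A.mulVec a = (m : ℤ) • v := by
    simp only [a, Matrix.mulVec_mulVec, Matrix.mul_adjugate, hm, Matrix.smul_mulVec,
      Matrix.one_mulVec]
  refine ⟨c k, m, a, v, hmpos, ?_, ?_, ?_⟩
  · have h1 : ((c k : ℤ) - 0) ∣ M.charpoly.eval (c k : ℤ) - M.charpoly.eval 0 :=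
      Polynomial.sub_dvd_eval_sub _ _ _
    rw [Matrix.eval_charpoly, Matrix.eval_charpoly] at h1
    change _ ∣ A.det - _ at h1
    rw [hm, sub_zero, map_zero, zero_sub, Matrix.det_neg] at h1
    obtain ⟨q, hq⟩ := h1
    have h2 : IsCoprime (c k : ℤ) M.det := by
      refine ⟨1, -(k * M.det.sign), ?_⟩
      simp only [c]
      push_cast
      have := Int.sign_mul_self_eq_abs M.det
      linear_combination (-(k:ℤ)) * this
    have h3 : IsCoprime (c k : ℤ) ((-1) ^ Fintype.card (Fin n) * M.det) := by
      refine IsCoprime.mul_right ?_ h2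
      exact (IsCoprime.pow_right (isCoprime_one_right.neg_right))
    have h4 : (m : ℤ) = (-1) ^ Fintype.card (Fin n) * M.det + (c k : ℤ) * q := by
      linear_combination hq
    rw [← Nat.isCoprime_iff_coprime, h4]
    exact h3.add_mul_left_right q
  · rw [← hAa]
    simp only [A, Matrix.sub_mulVec, Matrix.scalar_apply]
    ext i
    simp
  · have hyk : (fun i => (a i : ℝ) / (m : ℝ)) = y k := by
      have hBy : (B ((c k : ℝ)⁻¹)).mulVec (y k) = w k := by
        simp only [y, Matrix.mulVec_smul, Matrix.mulVec_mulVec, Matrix.mul_adjugate,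
          Matrix.smul_mulVec, Matrix.one_mulVec, smul_smul]
        rw [inv_mul_cancel₀ hk2.ne', one_smul]
      have hAy : (A.map (Int.cast : ℤ → ℝ)).mulVec (y k) = fun i => (v i : ℝ) := by
        rw [hAR, Matrix.smul_mulVec, hBy]
        funext i
        simp only [w, v, Pi.smul_apply, smul_eq_mul]
        push_cast
        field_simp
      have h5 : (A.map (Int.cast : ℤ → ℝ)).adjugate.mulVec
          ((A.map (Int.cast : ℤ → ℝ)).mulVec (y k)) = (m : ℝ) • y k := by
        rw [Matrix.mulVec_mulVec, Matrix.adjugate_mul, Matrix.smul_mulVec, Matrix.one_mulVec]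
        congr 1
        have h1 : ((A.det : ℤ) : ℝ) = (A.map (Int.cast : ℤ → ℝ)).det := Int.cast_det A
        rw [← h1, hm]
        simp
      have h6 : (A.map (Int.cast : ℤ → ℝ)).adjugate = A.adjugate.map (Int.cast : ℤ → ℝ) :=
        ((Int.castRingHom ℝ).map_adjugate A).symm
      have h7 : (fun i => (a i : ℝ)) = (m : ℝ) • y k := by
        rw [← h5, hAy, h6]
        funext i
        simp [a, Matrix.mulVec, dotProduct]
      funext i
      have := congrFun h7 i
      have hm' : (m : ℝ) ≠ 0 := by exact_mod_cast hmpos.ne'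
      simp only [Pi.smul_apply, smul_eq_mul] at this
      rw [this]
      field_simp
    have h8 : ∀ i, (a i : ℝ) / (m : ℝ) = y k i := fun i => congrFun hyk i
    simp only [h8]
    exact hk1

lemma aux_key {F : Type*} [Field F] (u : F) (m : ℕ) (hm : 0 < m) (hu : IsPrimitiveRoot u m)
    (a : ℤ) : u ^ a = u ^ (a % (m : ℤ)).toNat := by
  have h0 : u ≠ 0 := hu.ne_zero hm.ne'
  rw [← zpow_natCast, Int.toNat_of_nonneg (Int.emod_nonneg _ (by omega))]
  conv_lhs => rw [← Int.emod_add_mul_ediv a m]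
  rw [zpow_add₀ h0, zpow_mul, zpow_natCast, hu.pow_eq_one, one_zpow, mul_one]

lemma aux_transfer {K L : Type*} [Field K] [CharZero K] [Field L] [CharZero L] {n : ℕ}
    (g : MvPolynomial (Fin n) ℚ) (m : ℕ) (hm : 0 < m) (a : Fin n → ℤ) (z : K) (z' : L)
    (hz : IsPrimitiveRoot z m) (hz' : IsPrimitiveRoot z' m)
    (h : MvPolynomial.aeval (fun i => z ^ a i) g = 0) :
    MvPolynomial.aeval (fun i => z' ^ a i) g = 0 := by
  let b : Fin n → ℕ := fun i => (a i % (m : ℤ)).toNat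
  let P : Polynomial ℚ := MvPolynomial.aeval (fun i => (Polynomial.X : Polynomial ℚ) ^ b i) g
  have hP : Polynomial.aeval z P = 0 := by
    rw [← h]
    simp only [P]
    rw [MvPolynomial.comp_aeval_apply]
    simp [aux_key z m hm hz, b]
  have hdvd : Polynomial.cyclotomic m ℚ ∣ P := by
    rw [Polynomial.cyclotomic_eq_minpoly_rat hz hm]
    exact minpoly.dvd ℚ z hP
  rw [Polynomial.cyclotomic_eq_minpoly_rat hz' hm] at hdvd
  have hP' : Polynomial.aeval z' P = 0 := by
    obtain ⟨q, hq⟩ := hdvd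
    rw [hq, map_mul, minpoly.aeval, zero_mul]
  rw [← hP']
  simp only [P]
  rw [MvPolynomial.comp_aeval_apply]
  simp [aux_key z' m hm hz', b]

theorem no_proper_closed_subset_meets_all_periodic_torsion_orbits
    (K : Type*) [Field K] [IsAlgClosed K] [CharZero K]
    (n : ℕ) (hn : 1 ≤ n) (M : Matrix (Fin n) (Fin n) ℤ) (hM : M.det ≠ 0)
    (Y : Set (Fin n → Kˣ)) (hY : IsZariskiClosed Y) (hYproper : Y ≠ Set.univ) :
    ∃ x : Fin n → Kˣ,
      (∃ m : ℕ, 1 ≤ m ∧ x ^ m = 1) ∧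
      (∃ N : ℕ, 1 ≤ N ∧ (torusEndo M)^[N] x = x) ∧
      ∀ k : ℕ, (torusEndo M)^[k] x ∉ Y := by
  obtain ⟨S, rfl⟩ := hY
  obtain ⟨f, hfS, hf⟩ : ∃ f ∈ S, f ≠ 0 := by
    by_contra! h
    apply hYproper
    ext x
    simp only [Set.mem_ofPred_eq, Set.mem_univ, iff_true]
    intro f hf
    rw [h f hf, map_zero]
  obtain ⟨g, hg, hgf⟩ := aux_descend f hf
  obtain ⟨c, m, a, v, hm, hcm, hMa, hne⟩ := aux_main M hM g hg
  have : NeZero m := ⟨hm.ne'⟩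
  obtain ⟨z₀, hz₀⟩ := HasEnoughRootsOfUnity.exists_primitiveRoot K m
  obtain ⟨z, hz, hzz⟩ : ∃ z : Kˣ, IsPrimitiveRoot z m ∧ (z : K) = z₀ :=
    ⟨hz₀.toRootsOfUnity, (IsPrimitiveRoot.coe_units_iff).1 (by simpa using hz₀), by simp⟩
  have hzm : z ^ m = 1 := hz.pow_eq_one
  have hstep : ∀ e : ℕ, torusEndo M (fun i => (z ^ e) ^ a i) = fun i => (z ^ (e * c)) ^ a i := by
    intro e
    funext i
    have h1 : (z ^ e) ^ (m : ℤ) = 1 := by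
      rw [zpow_natCast, ← pow_mul, mul_comm, pow_mul, hzm, one_pow]
    have h2 : ∑ j, a j * M i j = (c : ℤ) * a i - (m : ℤ) * v i := by
      have := congrFun hMa i
      simp only [Matrix.mulVec, dotProduct, Pi.sub_apply, Pi.smul_apply, smul_eq_mul] at this
      rw [← this]
      exact Finset.sum_congr rfl fun j _ => mul_comm _ _
    have h3 : torusEndo M (fun i => (z ^ e) ^ a i) i = (z ^ e) ^ (∑ j, a j * M i j) := by
      simp only [torusEndo, ← zpow_mul]
      exact (map_sum (zpowersHom Kˣ (z ^ e)).toAdditiveRight _ _).symm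
    rw [h3, h2, zpow_sub, zpow_mul, zpow_mul _ (m : ℤ), h1, one_zpow, inv_one, mul_one,
      zpow_natCast, ← pow_mul]
  have hiter : ∀ k : ℕ, (torusEndo M)^[k] (fun i => z ^ a i) = fun i => (z ^ (c ^ k)) ^ a i := by
    intro k
    induction k with
    | zero => simp
    | succ k ih => rw [Function.iterate_succ_apply', ih, hstep, pow_succ]
  have htor : ∀ e : ℕ, (fun i => (z ^ e) ^ a i) ^ m = (1 : Fin n → Kˣ) := by
    intro e
    funext i
    simp only [Pi.pow_apply, Pi.one_apply]
    rw [← zpow_natCast, ← zpow_mul, mul_comm, zpow_mul, zpow_natCast, ← pow_mul, mul_comm e,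
      pow_mul, hzm, one_pow, one_zpow]
  refine ⟨fun i => z ^ a i, ⟨m, hm, by simpa using htor 1⟩,
    ⟨m.totient, Nat.totient_pos.2 hm, ?_⟩, ?_⟩
  · rw [hiter]
    have : z ^ (c ^ m.totient) = z := by
      have h1 := Nat.ModEq.pow_totient hcm
      have h2 : z ^ (c ^ m.totient) = z ^ 1 := pow_eq_pow_iff_modEq.2 (by rw [← hz.eq_orderOf]; exact h1)
      simpa using h2
    rw [this]
  · intro k hk
    rw [hiter] at hk
    have h0 := hgf _ ⟨m, hm, htor _⟩ (hk f hfS)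
    have hp : IsPrimitiveRoot ((z : K) ^ (c ^ k)) m :=
      (hzz ▸ hz₀).pow_of_coprime _ (Nat.Coprime.pow_left k hcm)
    have h1 := aux_transfer g m hm a ((z : K) ^ (c ^ k)) _ hp
      (Complex.isPrimitiveRoot_exp m hm.ne') (by simpa using h0)
    apply hne
    rw [← h1]
    congr 2
    funext i
    rw [← Complex.exp_int_mul]
    congr 1
    push_cast
    ring
end

section
/- Let K be an algebraically closed field of characteristic 0, let n ≥ 1, let M be an n×n integer matrix with det M ≠ 0, let a ∈ (Kˣ)^n, and let Φ : G → G be the dominant regular self-map of the torus G = (Kˣ)^n given by Φ(x) = a · Φ_M(x) (the composition of the group endomorphism Φ_M with translation by a). Call a nonempty Zariski-closed subset Z ⊆ G irreducible if whenever Z ⊆ Z₁ ∪ Z₂ with Z₁, Z₂ Zariski closed, then Z ⊆ Z₁ or Z ⊆ Z₂; call Z periodic under Φ if Φ^N(Z) = Z (image as a set) for some N ≥ 1. Then one of the following two statements holds: (A) there is a proper Zariski-closed subset X ⊊ G such that every proper, irreducible, Φ-periodic Zariski-closed subset Z of G satisfies Z ⊆ X; or (B) there is no proper Zariski-closed subset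 Y ⊊ G with the property that for every proper, irreducible, Φ-periodic Zariski-closed subset Z of G there is some m ≥ 0 with Φ^m(Z) ⊆ Y. (This is Theorem 1.3 of the paper in the case where the semiabelian variety is the algebraic torus G_m^n, which is the case used to derive Theorem 1.1.) -/
/-- A nonempty Zariski-closed set is irreducible if whenever it is covered by two
Zariski-closed sets, it is contained in one of them. -/
def IsIrreducibleClosed {K : Type*} [Field K] {ι : Type*} [Fintype ι]
    (Z : Set (ι → Kˣ)) : Prop :=
  Z.Nonempty ∧ IsZariskiClosed Z ∧
    ∀ Z₁ Z₂ : Set (ι → Kˣ), IsZariskiClosed Z₁ → IsZariskiClosed Z₂ →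
      Z ⊆ Z₁ ∪ Z₂ → Z ⊆ Z₁ ∨ Z ⊆ Z₂

/-- A set is periodic under `Φ` if some positive iterate of `Φ` maps it onto itself. -/
def IsPeriodicSet {α : Type*} (Φ : α → α) (Z : Set α) : Prop :=
  ∃ N : ℕ, 1 ≤ N ∧ Φ^[N] '' Z = Z

set_option linter.unusedSectionVars false
set_option linter.unusedSimpArgs false
set_option linter.unusedVariables false
set_option linter.style.longLine false
namespace TorDyn

section basics
variable {K : Type*} [Field K] {ι κ τ : Type*} [Fintype ι] [Fintype κ] [Fintype τ]

/-- character -/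
def chi (v : ι → ℤ) (x : ι → Kˣ) : Kˣ := ∏ j, x j ^ v j

/-- monomial map -/
def tE (A : Matrix κ ι ℤ) (x : ι → Kˣ) : κ → Kˣ := fun i => chi (A i) x

theorem torusEndo_eq (M : Matrix ι ι ℤ) (x : ι → Kˣ) : torusEndo M x = tE M x := rfl

theorem chi_zero (x : ι → Kˣ) : chi (0 : ι → ℤ) x = 1 := by simp [chi]

theorem chi_one (v : ι → ℤ) : chi v (1 : ι → Kˣ) = 1 := by simp [chi]

theorem chi_add (v w : ι → ℤ) (x : ι → Kˣ) : chi (v + w) x = chi v x * chi w x := by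
  simp [chi, zpow_add, Finset.prod_mul_distrib]

theorem chi_neg (v : ι → ℤ) (x : ι → Kˣ) : chi (-v) x = (chi v x)⁻¹ := by
  simp [chi]

theorem chi_sub (v w : ι → ℤ) (x : ι → Kˣ) : chi (v - w) x = chi v x / chi w x := by
  rw [sub_eq_add_neg, chi_add, chi_neg, div_eq_mul_inv]

theorem chi_mul (v : ι → ℤ) (x y : ι → Kˣ) : chi v (x * y) = chi v x * chi v y := by
  simp [chi, mul_zpow, Finset.prod_mul_distrib]

theorem chi_inv (v : ι → ℤ) (x : ι → Kˣ) : chi v (x⁻¹) = (chi v x)⁻¹ := by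
  simp [chi]

theorem chi_smul (d : ℤ) (v : ι → ℤ) (x : ι → Kˣ) : chi (d • v) x = chi v x ^ d := by
  simp [chi, Finset.prod_zpow, mul_comm d, zpow_mul]

theorem chi_zpow (d : ℤ) (v : ι → ℤ) (x : ι → Kˣ) : chi v (x ^ d) = chi v x ^ d := by
  rw [← chi_smul]
  simp [chi, zpow_mul]

theorem chi_vecMul (v : κ → ℤ) (A : Matrix κ ι ℤ) (x : ι → Kˣ) :
    chi (Matrix.vecMul v A) x = chi v (tE A x) := by
  simp only [chi, tE, Matrix.vecMul, dotProduct]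
  simp_rw [← Finset.prod_zpow, ← zpow_mul]
  rw [Finset.prod_comm]
  refine Finset.prod_congr rfl fun j _ => ?_
  have : ∀ (s : Finset κ) (f : κ → ℤ), x j ^ (∑ i ∈ s, f i) = ∏ i ∈ s, x j ^ f i := by
    classical
    intro s f
    induction s using Finset.induction_on with
    | empty => simp
    | insert a s ha ih => rw [Finset.sum_insert ha, Finset.prod_insert ha, zpow_add, ih]
  rw [this]
  refine Finset.prod_congr rfl fun i _ => ?_
  rw [mul_comm]

theorem tE_mul (A : Matrix κ ι ℤ) (x y : ι → Kˣ) : tE A (x * y) = tE A x * tE A y := by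
  ext i; simp [tE, chi_mul]

theorem tE_inv (A : Matrix κ ι ℤ) (x : ι → Kˣ) : tE A (x⁻¹) = (tE A x)⁻¹ := by
  ext i; simp [tE, chi_inv]

theorem tE_one_pt (A : Matrix κ ι ℤ) : tE A (1 : ι → Kˣ) = 1 := by
  ext i; simp [tE, chi_one]

theorem tE_comp (A : Matrix τ κ ℤ) (B : Matrix κ ι ℤ) (x : ι → Kˣ) :
    tE (A * B) x = tE A (tE B x) := by
  funext i
  simp only [tE]
  rw [show (A * B) i = Matrix.vecMul (A i) B from rfl, chi_vecMul]

theorem tE_one [DecidableEq ι] (x : ι → Kˣ) : tE (1 : Matrix ι ι ℤ) x = x := by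
  funext i
  simp only [tE, chi]
  rw [Finset.prod_eq_single i]
  · simp
  · intro j _ hj; simp [Matrix.one_apply_ne hj.symm]
  · simp

theorem tE_add (A B : Matrix κ ι ℤ) (x : ι → Kˣ) : tE (A + B) x = tE A x * tE B x := by
  funext i; exact chi_add _ _ _

theorem tE_sub (A B : Matrix κ ι ℤ) (x : ι → Kˣ) : tE (A - B) x = tE A x / tE B x := by
  funext i; exact chi_sub _ _ _

theorem tE_zero (x : ι → Kˣ) : tE (0 : Matrix κ ι ℤ) x = 1 := by
  funext i; exact chi_zero _

theorem tE_smul (d : ℤ) (A : Matrix κ ι ℤ) (x : ι → Kˣ) : tE (d • A) x = tE A x ^ d := by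
  funext i; exact chi_smul _ _ _

theorem tE_zpow (d : ℤ) (A : Matrix κ ι ℤ) (x : ι → Kˣ) : tE A (x ^ d) = tE A x ^ d := by
  funext i; exact chi_zpow _ _ _

variable (K) in
/-- Laurent polynomials -/
abbrev LP (ι : Type*) := AddMonoidAlgebra K (ι → ℤ)

/-- evaluation -/
noncomputable def ev (x : ι → Kˣ) : LP K ι →ₐ[K] K :=
  AddMonoidAlgebra.lift K K (ι → ℤ)
    { toFun := fun v => ((chi v.toAdd x : Kˣ) : K)
      map_one' := by simp [chi_zero]
      map_mul' := fun v w => by simp [chi_add] }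

theorem ev_single (x : ι → Kˣ) (v : ι → ℤ) (k : K) :
    ev x (AddMonoidAlgebra.single v k) = k * (chi v x : Kˣ) := by
  simp [ev, AddMonoidAlgebra.lift_single]

/-- pullback along `x ↦ c * tE A x` -/
noncomputable def pb (A : Matrix κ ι ℤ) (c : κ → Kˣ) : LP K κ →ₐ[K] LP K ι :=
  AddMonoidAlgebra.lift K (LP K ι) (κ → ℤ)
    { toFun := fun v => AddMonoidAlgebra.single (Matrix.vecMul v.toAdd A) ((chi v.toAdd c : Kˣ) : K)
      map_one' := by simp [chi_zero, AddMonoidAlgebra.one_def]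
      map_mul' := fun v w => by
        simp [chi_add, AddMonoidAlgebra.single_mul_single, Matrix.add_vecMul] }

theorem pb_single (A : Matrix κ ι ℤ) (c : κ → Kˣ) (v : κ → ℤ) (k : K) :
    pb A c (AddMonoidAlgebra.single v k) =
      AddMonoidAlgebra.single (Matrix.vecMul v A) (k * (chi v c : Kˣ)) := by
  simp [pb, AddMonoidAlgebra.lift_single]

theorem LP_induction {P : LP K ι → Prop} (h0 : P 0)
    (hs : ∀ v k, P (AddMonoidAlgebra.single v k)) (ha : ∀ f g, P f → P g → P (f + g))
    (f : LP K ι) : P f := by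
  have : ∀ g : (ι → ℤ) →₀ K, P (AddMonoidAlgebra.ofCoeff g) := by
    intro g
    induction g using Finsupp.induction_linear with
    | zero => exact h0
    | add f g hf hg => exact ha _ _ hf hg
    | single a b => exact hs a b
  exact this f.coeff

theorem ev_pb (A : Matrix κ ι ℤ) (c : κ → Kˣ) (x : ι → Kˣ) (f : LP K κ) :
    ev x (pb A c f) = ev (c * tE A x) f := by
  induction f using LP_induction with
  | h0 => simp
  | hs v k =>
    rw [pb_single, ev_single, ev_single, chi_mul, chi_vecMul]; push_cast; ring
  | ha f g hf hg => rw [map_add, map_add, map_add, hf, hg]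

/-- polynomial to Laurent polynomial -/
noncomputable def toLP [DecidableEq ι] (f : MvPolynomial ι K) : LP K ι :=
  MvPolynomial.aeval (fun i => AddMonoidAlgebra.single (Pi.single i (1:ℤ)) (1:K)) f

theorem chi_piSingle [DecidableEq ι] (i : ι) (x : ι → Kˣ) : chi (Pi.single i (1:ℤ)) x = x i := by
  rw [chi, Finset.prod_eq_single i]
  · simp
  · intro j _ hj; simp [hj]
  · simp

theorem ev_toLP [DecidableEq ι] (f : MvPolynomial ι K) (x : ι → Kˣ) :
    ev x (toLP f) = MvPolynomial.eval (fun i => (x i : K)) f := by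
  rw [toLP, ← AlgHom.comp_apply]
  have : (ev x).comp (MvPolynomial.aeval (fun i => AddMonoidAlgebra.single (Pi.single i (1:ℤ)) (1:K)))
      = MvPolynomial.aeval (fun i => (x i : K)) := by
    apply MvPolynomial.algHom_ext
    intro i
    simp [ev_single, chi_piSingle]
  rw [this, MvPolynomial.aeval_eq_eval]

/-- clearing denominators -/
theorem exists_poly (f : LP K ι) : ∃ (t : ℕ) (H : MvPolynomial ι K), ∀ x : ι → Kˣ,
    MvPolynomial.eval (fun i => (x i : K)) H = (∏ i, (x i : K)) ^ t * ev x f := by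
  induction f using LP_induction with
  | h0 => exact ⟨0, 0, by simp⟩
  | hs v k =>
    refine ⟨∑ i, (v i).natAbs, MvPolynomial.C k *
      ∏ i, MvPolynomial.X i ^ ((∑ i, (v i).natAbs : ℕ) + v i).toNat, fun x => ?_⟩
    rw [ev_single, chi]
    simp only [map_mul, map_prod, map_pow, MvPolynomial.eval_C, MvPolynomial.eval_X,
      Units.coe_prod, Units.val_zpow_eq_zpow_val]
    rw [mul_left_comm, ← Finset.prod_pow, ← Finset.prod_mul_distrib]
    congr 1
    refine Finset.prod_congr rfl fun i _ => ?_
    rw [← zpow_natCast, ← zpow_natCast, ← zpow_add₀ (x i).ne_zero]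
    congr 1
    rw [Int.toNat_of_nonneg]
    have : (v i).natAbs ≤ ∑ i, (v i).natAbs :=
      Finset.single_le_sum (f := fun i => (v i).natAbs) (fun _ _ => Nat.zero_le _) (Finset.mem_univ i)
    omega
  | ha f g hf hg =>
    obtain ⟨t, H, h⟩ := hf
    obtain ⟨s, J, j⟩ := hg
    refine ⟨t + s, (∏ i, MvPolynomial.X i) ^ s * H + (∏ i, MvPolynomial.X i) ^ t * J, fun x => ?_⟩
    simp only [map_add, map_mul, map_pow, map_prod, MvPolynomial.eval_X, h, j]
    ring

theorem prod_units_ne (x : ι → Kˣ) : (∏ i, (x i : K)) ≠ 0 :=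
  Finset.prod_ne_zero_iff.2 fun i _ => (x i).ne_zero

/-- a nonzero polynomial has a nonvanishing torus point -/
theorem exists_eval_ne [Infinite K] {H : MvPolynomial ι K} (hH : H ≠ 0) :
    ∃ x : ι → Kˣ, MvPolynomial.eval (fun i => (x i : K)) H ≠ 0 := by
  by_contra! hcon
  have hX : (∏ i : ι, (MvPolynomial.X i : MvPolynomial ι K)) ≠ 0 :=
    Finset.prod_ne_zero_iff.2 fun i _ => MvPolynomial.X_ne_zero i
  apply mul_ne_zero hX hH
  apply MvPolynomial.funext
  intro y
  simp only [map_mul, map_prod, MvPolynomial.eval_X, map_zero]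
  by_cases hy : ∃ i, y i = 0
  · obtain ⟨i, hi⟩ := hy
    rw [Finset.prod_eq_zero (Finset.mem_univ i) hi, zero_mul]
  · push Not at hy
    have := hcon (fun i => Units.mk0 (y i) (hy i))
    simp at this
    rw [this, mul_zero]

theorem exists_ev_mul_ne [Infinite K] {f g : LP K ι} (hf : ∃ x, ev x f ≠ 0) (hg : ∃ x, ev x g ≠ 0) :
    ∃ x, ev x (f * g) ≠ 0 := by
  obtain ⟨x, hx⟩ := hf
  obtain ⟨y, hy⟩ := hg
  obtain ⟨t, H, h⟩ := exists_poly f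
  obtain ⟨s, J, j⟩ := exists_poly g
  have hH : H ≠ 0 := by
    rintro rfl
    have := h x
    rw [map_zero] at this
    exact mul_ne_zero (pow_ne_zero _ (prod_units_ne x)) hx this.symm
  have hJ : J ≠ 0 := by
    rintro rfl
    have := j y
    rw [map_zero] at this
    exact mul_ne_zero (pow_ne_zero _ (prod_units_ne y)) hy this.symm
  obtain ⟨z, hz⟩ := exists_eval_ne (mul_ne_zero hH hJ)
  refine ⟨z, fun h0 => hz ?_⟩
  rw [map_mul, h, j]
  rw [map_mul] at h0
  linear_combination (∏ i, (z i : K)) ^ t * (∏ i, (z i : K)) ^ s * h0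

theorem exists_ev_prod_ne [Infinite K] {α : Type*} (s : Finset α) (f : α → LP K ι)
    (hf : ∀ i ∈ s, ∃ x, ev x (f i) ≠ 0) : ∃ x, ev x (∏ i ∈ s, f i) ≠ 0 := by
  classical
  induction s using Finset.induction_on with
  | empty => exact ⟨1, by simp⟩
  | insert a s ha ih =>
    rw [Finset.prod_insert ha]
    exact exists_ev_mul_ne (hf a (by simp)) (ih fun i hi => hf i (by simp [hi]))

theorem closed_iff_LP [DecidableEq ι] (Y : Set (ι → Kˣ)) :
    IsZariskiClosed Y ↔ ∃ S : Set (LP K ι), Y = {x | ∀ f ∈ S, ev x f = 0} := by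
  constructor
  · rintro ⟨S, rfl⟩
    refine ⟨toLP '' S, ?_⟩
    ext x
    simp [ev_toLP]
  · rintro ⟨S, rfl⟩
    choose t H h using (exists_poly (K := K) (ι := ι))
    refine ⟨H '' S, ?_⟩
    ext x
    simp only [Set.mem_ofPred_eq, Set.forall_mem_image, h]
    refine forall₂_congr fun f _ => ?_
    simp [pow_ne_zero, prod_units_ne x]

theorem closed_preimage [DecidableEq ι] [DecidableEq κ] {Y : Set (κ → Kˣ)} (hY : IsZariskiClosed Y) (A : Matrix κ ι ℤ)
    (c : κ → Kˣ) : IsZariskiClosed {x : ι → Kˣ | c * tE A x ∈ Y} := by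
  obtain ⟨S, rfl⟩ := (closed_iff_LP Y).1 hY
  refine (closed_iff_LP _).2 ⟨pb A c '' S, ?_⟩
  ext x
  simp [ev_pb]

theorem closed_singleton [DecidableEq ι] (p : ι → Kˣ) : IsZariskiClosed ({p} : Set (ι → Kˣ)) := by
  refine ⟨Set.range fun i => MvPolynomial.X i - MvPolynomial.C (p i : K), ?_⟩
  ext x
  simp [funext_iff, sub_eq_zero, Units.ext_iff]

theorem exists_ne_of_closed [DecidableEq ι] {Y : Set (ι → Kˣ)} (hY : IsZariskiClosed Y) (h : Y ≠ Set.univ) :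
    ∃ f : LP K ι, (∃ x, ev x f ≠ 0) ∧ ∀ x ∈ Y, ev x f = 0 := by
  obtain ⟨S, rfl⟩ := (closed_iff_LP Y).1 hY
  obtain ⟨x, hx⟩ := (Set.ne_univ_iff_exists_notMem _).1 h
  simp only [Set.mem_ofPred_eq, not_forall] at hx
  obtain ⟨f, hf, hx⟩ := hx
  exact ⟨f, ⟨x, hx⟩, fun y hy => hy f hf⟩

theorem irred_univ [Infinite K] [DecidableEq ι] {Z₁ Z₂ : Set (ι → Kˣ)} (h1 : IsZariskiClosed Z₁)
    (h2 : IsZariskiClosed Z₂) (h : ∀ x, x ∈ Z₁ ∪ Z₂) : (∀ x, x ∈ Z₁) ∨ (∀ x, x ∈ Z₂) := by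
  by_contra! hcon
  obtain ⟨⟨x, hx⟩, ⟨y, hy⟩⟩ := hcon
  obtain ⟨f, hf, hf'⟩ := exists_ne_of_closed h1 (fun h => hx (h ▸ Set.mem_univ x))
  obtain ⟨g, hg, hg'⟩ := exists_ne_of_closed h2 (fun h => hy (h ▸ Set.mem_univ y))
  obtain ⟨z, hz⟩ := exists_ev_mul_ne hf hg
  rw [map_mul] at hz
  rcases h z with hz' | hz'
  · exact hz (by rw [hf' z hz', zero_mul])
  · exact hz (by rw [hg' z hz', mul_zero])

theorem exists_zpow_root [IsAlgClosed K] (d : ℤ) (hd : d ≠ 0) (x : ι → Kˣ) : ∃ y : ι → Kˣ, y ^ d = x := by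
  have key : ∀ (m : ℕ), m ≠ 0 → ∀ u : Kˣ, ∃ w : Kˣ, w ^ m = u := by
    intro m hm u
    obtain ⟨z, hz⟩ := IsAlgClosed.exists_pow_nat_eq (u : K) (Nat.pos_of_ne_zero hm)
    have hz0 : z ≠ 0 := by rintro rfl; rw [zero_pow hm] at hz; exact u.ne_zero hz.symm
    exact ⟨Units.mk0 z hz0, by ext; simpa using hz⟩
  choose f hf using key d.natAbs (by simpa using hd)
  rcases Int.natAbs_eq d with h | h
  · refine ⟨fun i => f (x i), ?_⟩
    funext i
    rw [Pi.pow_apply, h, zpow_natCast, hf]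
  · refine ⟨fun i => (f (x i))⁻¹, ?_⟩
    funext i
    rw [Pi.pow_apply, h, zpow_neg, zpow_natCast, inv_pow, inv_inv, hf]

theorem tE_surj [IsAlgClosed K] [DecidableEq ι] (M : Matrix ι ι ℤ) (hM : M.det ≠ 0) (x : ι → Kˣ) :
    ∃ y, tE M y = x := by
  obtain ⟨z, hz⟩ := exists_zpow_root M.det hM x
  refine ⟨tE M.adjugate z, ?_⟩
  rw [← tE_comp, Matrix.mul_adjugate, tE_smul, tE_one, hz]

end basics
end TorDyn

set_option linter.unusedSectionVars false
set_option linter.unusedSimpArgs false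
namespace TorDyn
section fibres
variable {K : Type*} [Field K] {ι κ : Type*} [Fintype ι] [Fintype κ] [DecidableEq ι] [DecidableEq κ]

theorem semiconj_fib {M : Matrix ι ι ℤ} {B : Matrix κ ι ℤ} {C : Matrix κ κ ℤ} (hBM : B * M = C * B)
    (a x : ι → Kˣ) : tE B (a * tE M x) = tE B a * tE C (tE B x) := by
  rw [tE_mul, ← tE_comp, hBM, tE_comp]

theorem image_fib [IsAlgClosed K] {M : Matrix ι ι ℤ} (hM : M.det ≠ 0) {B : Matrix κ ι ℤ}
    {S : Matrix ι κ ℤ} {C : Matrix κ κ ℤ} (hBS : B * S = 1) (hBM : B * M = C * B)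
    (a : ι → Kˣ) (p : κ → Kˣ) :
    (fun x => a * tE M x) '' {x | tE B x = p} = {x | tE B x = tE B a * tE C p} := by
  have hE : B * (1 - S * B) = 0 := by
    rw [Matrix.mul_sub, ← Matrix.mul_assoc, hBS, Matrix.mul_one, Matrix.one_mul, sub_self]
  have hC : C.det ≠ 0 := by
    have h1 : C * (B * M.adjugate * S) = M.det • (1 : Matrix κ κ ℤ) := by
      rw [← Matrix.mul_assoc, ← Matrix.mul_assoc, ← hBM, Matrix.mul_assoc B, Matrix.mul_adjugate,
        Matrix.mul_smul, Matrix.smul_mul, Matrix.mul_one, hBS]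
    intro h0
    have := congrArg Matrix.det h1
    rw [Matrix.det_mul, h0, zero_mul, Matrix.det_smul, Matrix.det_one, mul_one] at this
    exact pow_ne_zero _ hM this.symm
  have hBE : B * M.adjugate * (1 - S * B) = 0 := by
    have h1 : C * (B * M.adjugate * (1 - S * B)) = 0 := by
      rw [← Matrix.mul_assoc, ← Matrix.mul_assoc, ← hBM, Matrix.mul_assoc B, Matrix.mul_adjugate]
      rw [Matrix.mul_smul, Matrix.smul_mul, Matrix.mul_one, hE, smul_zero]
    have h2 : C.adjugate * (C * (B * M.adjugate * (1 - S * B))) = 0 := by rw [h1, Matrix.mul_zero]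
    rw [← Matrix.mul_assoc, Matrix.adjugate_mul, Matrix.smul_mul, Matrix.one_mul] at h2
    exact (smul_eq_zero.1 h2).resolve_left hC
  ext x
  constructor
  · rintro ⟨y, hy, rfl⟩
    change tE B y = p at hy
    change tE B (a * tE M y) = _
    rw [semiconj_fib hBM, hy]
  · intro hx
    change tE B x = _ at hx
    -- base point
    set y0 := tE S p with hy0
    have hBy0 : tE B y0 = p := by rw [hy0, ← tE_comp, hBS, tE_one]
    set t := x / (a * tE M y0) with ht
    have hBt : tE B t = 1 := by
      rw [ht, div_eq_mul_inv, tE_mul, tE_inv, semiconj_fib hBM, hBy0, hx, mul_inv_cancel]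
    obtain ⟨z, hz⟩ := exists_zpow_root M.det hM t
    have hEt : tE (1 - S * B) t = t := by
      rw [tE_sub, tE_one, tE_comp, hBt, tE_one_pt, div_one]
    refine ⟨y0 * tE M.adjugate (tE (1 - S * B) z), ?_, ?_⟩
    · change tE B _ = p
      rw [tE_mul, hBy0, ← tE_comp, ← tE_comp, hBE, tE_zero, mul_one]
    · change a * tE M _ = x
      rw [tE_mul, ← tE_comp M M.adjugate, Matrix.mul_adjugate, tE_smul, tE_one, ← tE_zpow, hz, hEt, ht,
        ← mul_assoc, mul_div_cancel]

theorem iterate_image_fib [IsAlgClosed K] {M : Matrix ι ι ℤ} (hM : M.det ≠ 0) {B : Matrix κ ι ℤ}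
    {S : Matrix ι κ ℤ} {C : Matrix κ κ ℤ} (hBS : B * S = 1) (hBM : B * M = C * B)
    (a : ι → Kˣ) (p : κ → Kˣ) (m : ℕ) :
    (fun x => a * tE M x)^[m] '' {x | tE B x = p} =
      {x | tE B x = (fun y => tE B a * tE C y)^[m] p} := by
  induction m with
  | zero => simp
  | succ m ih =>
    rw [Function.iterate_succ', Set.image_comp, ih, image_fib hM hBS hBM, Function.iterate_succ']
    rfl

theorem irred_fib [Infinite K] {B : Matrix κ ι ℤ}
    {S : Matrix ι κ ℤ} (hBS : B * S = 1) (p : κ → Kˣ) :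
    IsIrreducibleClosed {x : ι → Kˣ | tE B x = p} := by
  have hE : B * (1 - S * B) = 0 := by
    rw [Matrix.mul_sub, ← Matrix.mul_assoc, hBS, Matrix.mul_one, Matrix.one_mul, sub_self]
  have hBy0 : tE B (tE S p) = p := by rw [← tE_comp, hBS, tE_one]
  refine ⟨⟨tE S p, hBy0⟩, ?_, ?_⟩
  · have := closed_preimage (closed_singleton p) B 1
    simpa using this
  · intro Z₁ Z₂ h1 h2 h
    have key := irred_univ (closed_preimage h1 (1 - S * B) (tE S p))
      (closed_preimage h2 (1 - S * B) (tE S p)) (fun x => by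
        have : tE S p * tE (1 - S * B) x ∈ Z₁ ∪ Z₂ := by
          apply h
          change tE B _ = p
          rw [tE_mul, hBy0, ← tE_comp, hE, tE_zero, mul_one]
        exact this)
    have hx : ∀ x : ι → Kˣ, tE B x = p → tE S p * tE (1 - S * B) x = x := by
      intro x hx
      rw [tE_sub, tE_one, tE_comp, hx, mul_div_cancel]
    rcases key with k | k
    · left; intro x hx'; have := k x; change _ ∈ Z₁ at this; rwa [hx x hx'] at this
    · right; intro x hx'; have := k x; change _ ∈ Z₂ at this; rwa [hx x hx'] at this

/-- criterion for (B) -/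
theorem B_of_fib [IsAlgClosed K] {M : Matrix ι ι ℤ} (hM : M.det ≠ 0) {B : Matrix κ ι ℤ}
    {S : Matrix ι κ ℤ} {C : Matrix κ κ ℤ} [Nonempty κ] (hBS : B * S = 1) (hBM : B * M = C * B)
    (a : ι → Kˣ) (Φ : (ι → Kˣ) → (ι → Kˣ)) (hΦ : Φ = fun x => a * tE M x)
    (hp : ∀ f : LP K ι, (∃ x, ev x f ≠ 0) → ∃ (p : κ → Kˣ) (N : ℕ), 1 ≤ N ∧
      (fun y => tE B a * tE C y)^[N] p = p ∧
      ∀ m : ℕ, ∃ x, tE B x = (fun y => tE B a * tE C y)^[m] p ∧ ev x f ≠ 0) :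
    ¬ ∃ Y : Set (ι → Kˣ), IsZariskiClosed Y ∧ Y ≠ Set.univ ∧
      ∀ Z : Set (ι → Kˣ), Z ≠ Set.univ → IsIrreducibleClosed Z →
        IsPeriodicSet Φ Z → ∃ m : ℕ, Φ^[m] '' Z ⊆ Y := by
  rintro ⟨Y, hY, hYu, h⟩
  have : Infinite K := IsAlgClosed.instInfinite
  obtain ⟨f, hf, hfY⟩ := exists_ne_of_closed hY hYu
  obtain ⟨p, N, hN, hNp, hm⟩ := hp f hf
  have hne : ({x : ι → Kˣ | tE B x = p}) ≠ Set.univ := by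
    intro hu
    have h1 : ∀ y : κ → Kˣ, y = p := by
      intro y
      have : tE S y ∈ ({x : ι → Kˣ | tE B x = p}) := hu ▸ Set.mem_univ _
      change tE B _ = p at this
      rwa [← tE_comp, hBS, tE_one] at this
    classical
    obtain ⟨u, hu⟩ := (Infinite.exists_notMem_finset (insert 0 {1} : Finset K))
    simp at hu
    have h2 := (h1 (fun _ => Units.mk0 u hu.1)).trans (h1 1).symm
    have h3 := congrFun h2 (Classical.arbitrary κ)
    apply hu.2
    simpa [Units.ext_iff] using h3
  obtain ⟨m, hmY⟩ := h _ hne (irred_fib hBS p) ⟨N, hN, by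
    rw [hΦ, iterate_image_fib hM hBS hBM, hNp]⟩
  rw [hΦ, iterate_image_fib hM hBS hBM] at hmY
  obtain ⟨x, hx, hx'⟩ := hm m
  exact hx' (hfY x (hmY hx))

/-- case of an invariant character -/
theorem B_of_char [IsAlgClosed K] {M : Matrix ι ι ℤ} (hM : M.det ≠ 0)
    (a : ι → Kˣ) (Φ : (ι → Kˣ) → (ι → Kˣ)) (hΦ : Φ = fun x => a * tE M x)
    (v : ι → ℤ) (hv : v ≠ 0) (hvM : Matrix.vecMul v M = v) (hva : chi v a = 1) :
    ¬ ∃ Y : Set (ι → Kˣ), IsZariskiClosed Y ∧ Y ≠ Set.univ ∧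
      ∀ Z : Set (ι → Kˣ), Z ≠ Set.univ → IsIrreducibleClosed Z →
        IsPeriodicSet Φ Z → ∃ m : ℕ, Φ^[m] '' Z ⊆ Y := by
  have : Infinite K := IsAlgClosed.instInfinite
  obtain ⟨d, u, w, hd, hvw, huw⟩ : ∃ (d : ℕ) (u w : ι → ℤ), d ≠ 0 ∧ v = (d : ℤ) • w ∧ ∑ i, w i * u i = 1 := by
    obtain ⟨d, hd⟩ := (IsPrincipalIdealRing.principal (Ideal.span (Set.range v))).principal
    have hdv : ∀ i, d ∣ v i := fun i => by
      have : v i ∈ Ideal.span (Set.range v) := Ideal.subset_span ⟨i, rfl⟩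
      rw [hd] at this
      exact Ideal.mem_span_singleton.1 this
    have hd0 : d ≠ 0 := by
      rintro rfl
      apply hv; funext i; simpa using hdv i
    have hdm : d ∈ Ideal.span (Set.range v) := by
      rw [hd]; exact Ideal.mem_span_singleton_self d
    obtain ⟨c, hc⟩ := (Ideal.mem_span_range_iff_exists_fun).1 hdm
    choose w hw using hdv
    have hsum : ∑ i, w i * c i = 1 := by
      apply mul_left_cancel₀ hd0
      rw [Finset.mul_sum, mul_one]
      conv_rhs => rw [← hc]
      refine Finset.sum_congr rfl fun i _ => ?_
      rw [hw i]; ring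
    rcases Int.natAbs_eq d with h | h
    · refine ⟨d.natAbs, c, w, by simpa using hd0, ?_, hsum⟩
      rw [← h]; funext i; simp [hw i]
    · refine ⟨d.natAbs, -c, -w, by simpa using hd0, ?_, by simpa using hsum⟩
      rw [smul_neg, ← neg_smul, ← h]; funext i; simp [hw i]
  have hwM : Matrix.vecMul w M = w := by
    have : (d : ℤ) • Matrix.vecMul w M = (d : ℤ) • w := by
      rw [← Matrix.smul_vecMul, ← hvw, hvM]
    exact smul_right_injective _ (by exact_mod_cast hd) this
  have hwa : chi w a ^ d = 1 := by
    rw [hvw, chi_smul] at hva; exact_mod_cast hva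
  have hit : ∀ (m : ℕ) (y : Unit → Kˣ),
      (fun y => tE (Matrix.of fun _ : Unit => w) a * tE (1 : Matrix Unit Unit ℤ) y)^[m] y =
        fun _ => chi w a ^ m * y () := by
    intro m y
    induction m with
    | zero => funext i; simp
    | succ m ih =>
      rw [Function.iterate_succ_apply', ih]
      funext i
      rw [tE_one, Pi.mul_apply, pow_succ']
      rw [mul_assoc]; rfl
  refine B_of_fib (κ := Unit) hM (B := Matrix.of fun _ => w) (S := Matrix.of fun i _ => u i) (C := 1)
    ?_ ?_ a Φ hΦ ?_
  · ext i j; simp [Matrix.mul_apply, huw]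
  · ext i j
    rw [Matrix.one_mul]
    exact congrFun hwM j
  · intro f hf
    have hsm : ∀ (m : ℕ) (x : ι → Kˣ), ev x ((pb M a)^[m] f) = ev ((fun x => a * tE M x)^[m] x) f := by
      intro m
      induction m with
      | zero => simp
      | succ m ih =>
        intro x
        rw [Function.iterate_succ_apply', ev_pb, ih, Function.iterate_succ_apply]
    have hsurj : ∀ m : ℕ, ∃ x, ev x ((pb M a)^[m] f) ≠ 0 := by
      intro m
      have hs : Function.Surjective (fun x : ι → Kˣ => a * tE M x) := by
        intro x
        obtain ⟨y, hy⟩ := tE_surj M hM (x / a)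
        exact ⟨y, by simp [hy]⟩
      obtain ⟨x, hx⟩ := hf
      obtain ⟨y, rfl⟩ := hs.iterate m x
      exact ⟨y, by rwa [hsm]⟩
    obtain ⟨x, hx⟩ := exists_ev_prod_ne (Finset.range d) (fun m => (pb M a)^[m] f)
      (fun m _ => hsurj m)
    rw [map_prod, Finset.prod_ne_zero_iff] at hx
    refine ⟨fun _ => chi w x, d, Nat.one_le_iff_ne_zero.2 hd, ?_, ?_⟩
    · rw [hit, hwa]; simp
    · intro m
      refine ⟨(fun x => a * tE M x)^[m % d] x, ?_, ?_⟩
      · rw [hit]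
        have h1 : ∀ (k : ℕ) (x : ι → Kˣ), chi w ((fun x => a * tE M x)^[k] x) = chi w a ^ k * chi w x := by
          intro k
          induction k with
          | zero => simp
          | succ k ih =>
            intro x
            rw [Function.iterate_succ_apply, ih, chi_mul, ← chi_vecMul, hwM,
              pow_succ, mul_assoc]
        funext i
        change chi w _ = _
        rw [h1]
        congr 1
        conv_rhs => rw [← Nat.mod_add_div m d, pow_add, pow_mul, hwa, one_pow, mul_one]
      · rw [← hsm]
        exact hx _ (Finset.mem_range.2 (Nat.mod_lt _ (Nat.pos_of_ne_zero hd)))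

end fibres
end TorDyn

set_option linter.unusedSectionVars false
set_option linter.unusedSimpArgs false
namespace TorDyn

theorem exists_order {n : ℕ} (M : Matrix (Fin n) (Fin n) ℤ) (k : ℕ) (hN : (M - 1) ^ k = 0) :
    ∃ (Γ : Type) (_ : AddCommGroup Γ) (_ : LinearOrder Γ) (_ : IsOrderedAddMonoid Γ)
      (D : (Fin n → ℤ) →+ Γ), Function.Injective D ∧
      ∀ v w, D v < D w → D (Matrix.vecMul v M) < D (Matrix.vecMul w M) := by
  let D : (Fin n → ℤ) →+ Lex ((Fin (k+1) ×ₗ Fin n) → ℤ) :=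
    { toFun := fun v => toLex fun q => (Matrix.vecMul v ((M - 1) ^ (k - (ofLex q).1.1))) (ofLex q).2
      map_zero' := by
        apply ofLex.injective
        funext q
        simp
        rfl
      map_add' := fun v w => by
        apply ofLex.injective
        funext q
        simp [Matrix.add_vecMul]
        rfl }
  have hD : ∀ v (i : Fin (k+1)) (j : Fin n), (ofLex (D v)) (toLex (i, j)) =
    (Matrix.vecMul v ((M - 1) ^ (k - i.1))) j := fun v i j => rfl
  have hpos : ∀ z, 0 < D z → 0 < D (Matrix.vecMul z M) := by
    rintro z ⟨⟨i, j⟩, h1, h2⟩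
    change ∀ q < toLex (i, j), (0:ℤ) = ofLex (D z) q at h1
    change 0 < ofLex (D z) (toLex (i, j)) at h2
    have hstep : ∀ (i' : Fin (k+1)) (j' : Fin n), i' ≤ i →
        ofLex (D (Matrix.vecMul z M)) (toLex (i', j')) = ofLex (D z) (toLex (i', j')) := by
      intro i' j' hi'
      rw [hD, hD]
      have e1 : Matrix.vecMul (Matrix.vecMul z M) ((M - 1) ^ (k - i'.1)) =
          Matrix.vecMul z ((M - 1) ^ (k - i'.1)) + Matrix.vecMul z ((M - 1) ^ (k - i'.1 + 1)) := by
        rw [Matrix.vecMul_vecMul, ← Matrix.vecMul_add, pow_succ']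
        congr 1
        noncomm_ring
      rw [e1, Pi.add_apply]
      have e2 : Matrix.vecMul z ((M - 1) ^ (k - i'.1 + 1)) j' = 0 := by
        by_cases h0 : i'.1 = 0
        · rw [h0, Nat.sub_zero, pow_succ, hN]; simp
        · have hlt : i'.1 - 1 < k + 1 := by omega
          have h3 := h1 (toLex (⟨i'.1 - 1, hlt⟩, j')) (by
            rw [Prod.Lex.toLex_lt_toLex]
            left
            rw [Fin.lt_def]
            have := Fin.le_def.1 hi'
            simp only
            omega)
          rw [hD] at h3
          rw [h3]
          congr 3
          simp only
          omega
      rw [e2, add_zero]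
    refine ⟨toLex (i, j), ?_, ?_⟩
    · intro q hq
      obtain ⟨⟨i', j'⟩, rfl⟩ := toLex.surjective q
      change (0:ℤ) = ofLex (D _) (toLex (i', j'))
      have hle : i' ≤ i := by
        rcases Prod.Lex.toLex_lt_toLex.1 hq with h | h
        · exact h.le
        · exact h.1.le
      rw [hstep i' j' hle]
      exact h1 _ hq
    · change (0:ℤ) < ofLex (D _) (toLex (i, j))
      rw [hstep i j le_rfl]
      exact h2
  refine ⟨Lex ((Fin (k+1) ×ₗ Fin n) → ℤ), inferInstance, inferInstance, inferInstance, D, ?_, ?_⟩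
  · rw [injective_iff_map_eq_zero]
    intro v hv
    funext j
    have := hD v ⟨k, by omega⟩ j
    rw [hv] at this
    have h2 := this.symm
    simp at h2
    exact h2.trans rfl
  · intro v w h
    have := hpos (w - v) (by rw [map_sub]; exact sub_pos.2 h)
    rw [Matrix.sub_vecMul, map_sub] at this
    exact sub_pos.1 this

section lead
variable {K : Type*} [Field K] {ι : Type*} [Fintype ι] [DecidableEq ι]
variable {Γ : Type} [AddCommGroup Γ] [LinearOrder Γ] [IsOrderedAddMonoid Γ]

/-- leading exponent -/
def IsLead (D : (ι → ℤ) →+ Γ) (f : LP K ι) (p : ι → ℤ) : Prop :=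
  f.coeff p ≠ 0 ∧ ∀ v, f.coeff v ≠ 0 → D v ≤ D p

theorem exists_lead (D : (ι → ℤ) →+ Γ) (f : LP K ι) (hf : f ≠ 0) : ∃ p, IsLead D f p := by
  have : f.coeff.support.Nonempty := by
    rw [Finsupp.support_nonempty_iff]
    exact fun h => hf (AddMonoidAlgebra.coeff_eq_zero.1 h)
  obtain ⟨p, hp, h⟩ := Finset.exists_max_image _ D this
  exact ⟨p, Finsupp.mem_support_iff.1 hp, fun v hv => h v (Finsupp.mem_support_iff.2 hv)⟩

theorem lead_unique {D : (ι → ℤ) →+ Γ} (hD : Function.Injective D) {f : LP K ι} {p q : ι → ℤ}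
    (hp : IsLead D f p) (hq : IsLead D f q) : p = q :=
  hD (le_antisymm (hq.2 p hp.1) (hp.2 q hq.1))

theorem support_mul {f g : LP K ι} {u : ι → ℤ} (h : (f * g).coeff u ≠ 0) :
    ∃ v w, f.coeff v ≠ 0 ∧ g.coeff w ≠ 0 ∧ v + w = u := by
  have := AddMonoidAlgebra.support_coeff_mul_subset f g (Finsupp.mem_support_iff.2 h)
  obtain ⟨v, hv, w, hw, rfl⟩ := Finset.mem_add.1 this
  exact ⟨v, w, Finsupp.mem_support_iff.1 hv, Finsupp.mem_support_iff.1 hw, rfl⟩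

theorem lead_mul {D : (ι → ℤ) →+ Γ} (hD : Function.Injective D) {f g : LP K ι} {p q : ι → ℤ}
    (hp : IsLead D f p) (hq : IsLead D g q) :
    IsLead D (f * g) (p + q) ∧ (f * g).coeff (p + q) = f.coeff p * g.coeff q := by
  have h1 : (f * g).coeff (p + q) = f.coeff p * g.coeff q := by
    apply AddMonoidAlgebra.coeff_mul_add_of_uniqueAdd
    intro v w hv hw hvw
    have a1 := hp.2 v (Finsupp.mem_support_iff.1 hv)
    have a2 := hq.2 w (Finsupp.mem_support_iff.1 hw)
    have a3 : D v + D w = D p + D q := by rw [← map_add, hvw, map_add]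
    have a4 : D v = D p := by
      apply le_antisymm a1
      by_contra hlt
      push Not at hlt
      exact (add_lt_add_of_lt_of_le hlt a2).ne a3
    have a5 : v = p := hD a4
    subst a5
    exact ⟨rfl, add_left_cancel hvw⟩
  refine ⟨⟨?_, ?_⟩, h1⟩
  · rw [h1]; exact mul_ne_zero hp.1 hq.1
  · intro u hu
    obtain ⟨v, w, hv, hw, rfl⟩ := support_mul hu
    rw [map_add, map_add]
    exact add_le_add (hp.2 v hv) (hq.2 w hw)

theorem coeff_pb {M : Matrix ι ι ℤ} (hM : Function.Injective fun v => Matrix.vecMul v M)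
    (a : ι → Kˣ) (f : LP K ι) (v : ι → ℤ) :
    (pb M a f).coeff (Matrix.vecMul v M) = f.coeff v * (chi v a : Kˣ) := by
  induction f using LP_induction with
  | h0 => simp
  | hs w k =>
    rw [pb_single, AddMonoidAlgebra.coeff_single, AddMonoidAlgebra.coeff_single]
    by_cases h : w = v
    · subst h; simp
    · rw [Finsupp.single_eq_of_ne (fun h' => h (hM h'.symm)), Finsupp.single_eq_of_ne (Ne.symm h), zero_mul]
  | ha f g hf hg =>
    rw [map_add, AddMonoidAlgebra.coeff_add, AddMonoidAlgebra.coeff_add, Finsupp.add_apply,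
      Finsupp.add_apply, hf, hg, add_mul]

theorem support_pb {M : Matrix ι ι ℤ} (hM : Function.Injective fun v => Matrix.vecMul v M)
    (a : ι → Kˣ) (f : LP K ι) (u : ι → ℤ) (hu : (pb M a f).coeff u ≠ 0) :
    ∃ v, f.coeff v ≠ 0 ∧ Matrix.vecMul v M = u := by
  have h1 : ∃ v, Matrix.vecMul v M = u := by
    by_contra hcon
    push Not at hcon
    apply hu
    clear hu
    induction f using LP_induction with
    | h0 => simp
    | hs w k =>
      rw [pb_single, AddMonoidAlgebra.coeff_single, Finsupp.single_eq_of_ne (hcon w).symm]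
    | ha f g hf hg =>
      rw [map_add, AddMonoidAlgebra.coeff_add, Finsupp.add_apply, hf, hg, add_zero]
  obtain ⟨v, rfl⟩ := h1
  refine ⟨v, fun h0 => hu ?_, rfl⟩
  rw [coeff_pb hM, h0, zero_mul]

theorem lead_pb {D : (ι → ℤ) →+ Γ} {M : Matrix ι ι ℤ}
    (hM : Function.Injective fun v => Matrix.vecMul v M)
    (hDM : ∀ v w, D v < D w → D (Matrix.vecMul v M) < D (Matrix.vecMul w M))
    (hD : Function.Injective D)
    (a : ι → Kˣ) {f : LP K ι} {p : ι → ℤ} (hp : IsLead D f p) :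
    IsLead D (pb M a f) (Matrix.vecMul p M) := by
  refine ⟨?_, ?_⟩
  · rw [coeff_pb hM]; exact mul_ne_zero hp.1 (Units.ne_zero _)
  · intro u hu
    obtain ⟨v, hv, rfl⟩ := support_pb hM a f u hu
    rcases (hp.2 v hv).lt_or_eq with h | h
    · exact (hDM _ _ h).le
    · rw [hD h]

end lead

section core
variable {K : Type*} [Field K] {n : ℕ}

theorem core {M : Matrix (Fin n) (Fin n) ℤ} (hM : M.det ≠ 0) (k : ℕ) (hN : (M - 1) ^ k = 0)
    (a : Fin n → Kˣ) (I : Ideal (LP K (Fin n))) (hI : ∀ f ∈ I, pb M a f ∈ I) (hI0 : ∃ f ∈ I, f ≠ 0)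
    (hI1 : I ≠ ⊤) : ∃ v : Fin n → ℤ, v ≠ 0 ∧ Matrix.vecMul v M = v ∧ chi v a = 1 := by
  classical
  obtain ⟨Γ, _, _, _, D, hD, hDM⟩ := exists_order M k hN
  have hinj : Function.Injective fun v => Matrix.vecMul v M := by
    intro v w h
    have : Matrix.vecMul (v - w) M = 0 := by
      rw [Matrix.sub_vecMul]; exact sub_eq_zero.2 h
    exact sub_eq_zero.1 (Matrix.eq_zero_of_vecMul_eq_zero hM this)
  set N := M - 1 with hNdef
  have hsingle : ∀ (v : Fin n → ℤ) (c : K), c ≠ 0 → AddMonoidAlgebra.single v c ∉ I := by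
    intro v c hc hm
    apply hI1
    rw [Ideal.eq_top_iff_one]
    have := I.mul_mem_left (AddMonoidAlgebra.single (-v) c⁻¹) hm
    rw [AddMonoidAlgebra.single_mul_single, neg_add_cancel, inv_mul_cancel₀ hc] at this
    exact this
  have hvM : ∀ (v : Fin n → ℤ) (j : ℕ), Matrix.vecMul (Matrix.vecMul v M) (N ^ j) =
      Matrix.vecMul v (N ^ j) + Matrix.vecMul v (N ^ (j + 1)) := by
    intro v j
    rw [Matrix.vecMul_vecMul, ← Matrix.vecMul_add, pow_succ', hNdef]
    congr 1
    noncomm_ring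
  let Good : ℕ → Prop := fun j => ∃ f ∈ I, f ≠ 0 ∧ ∀ v, f.coeff v ≠ 0 → Matrix.vecMul v (N ^ j) = 0
  have hex : ∃ j, Good j := by
    obtain ⟨f, hf, hf0⟩ := hI0
    exact ⟨k, f, hf, hf0, fun v _ => by rw [hN, Matrix.vecMul_zero]⟩
  have hfind := Nat.find_spec hex
  have hmin := fun m => Nat.find_min (m := m) hex
  rcases hk : Nat.find hex with _ | j
  · exfalso
    rw [hk] at hfind
    obtain ⟨f, hf, hf0, hs⟩ := hfind
    have : f = AddMonoidAlgebra.single 0 (f.coeff 0) := by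
      apply AddMonoidAlgebra.coeff_injective
      ext v
      rw [AddMonoidAlgebra.coeff_single]
      by_cases hv : v = 0
      · subst hv; simp
      · rw [Finsupp.single_eq_of_ne hv]
        by_contra h
        apply hv
        simpa using hs v h
    have h0 : f.coeff 0 ≠ 0 := fun h => hf0 (by rw [this, h]; simp)
    exact hsingle _ _ h0 (this ▸ hf)
  · rw [hk] at hfind
    have hnot : ¬ Good j := hmin j (by omega)
    -- minimal number of classes
    let cl : LP K (Fin n) → Finset (Fin n → ℤ) := fun f => f.coeff.support.image fun v => Matrix.vecMul v (N ^ j)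
    let Q : ℕ → Prop := fun c => ∃ f ∈ I, f ≠ 0 ∧ (∀ v, f.coeff v ≠ 0 → Matrix.vecMul v (N ^ (j+1)) = 0) ∧
      (cl f).card = c
    have hQ : ∃ c, Q c := by
      obtain ⟨f, h1, h2, h3⟩ := hfind
      exact ⟨_, f, h1, h2, h3, rfl⟩
    obtain ⟨f, hfI, hf0, hfs, hfc⟩ := Nat.find_spec hQ
    have hQmin : ∀ g ∈ I, (∀ v, g.coeff v ≠ 0 → Matrix.vecMul v (N ^ (j+1)) = 0) →
        (cl g).card < (cl f).card → g = 0 := by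
      intro g hg hgs hlt
      by_contra hg0
      rw [hfc] at hlt
      exact Nat.find_min hQ hlt ⟨g, hg, hg0, hgs, rfl⟩
    obtain ⟨v0, hv0, -⟩ := exists_lead D f hf0
    have hv1 : ∃ v1, f.coeff v1 ≠ 0 ∧ Matrix.vecMul v1 (N ^ j) ≠ Matrix.vecMul v0 (N ^ j) := by
      by_contra hcon
      push Not at hcon
      apply hnot
      refine ⟨AddMonoidAlgebra.single (-v0) 1 * f, I.mul_mem_left _ hfI, ?_, ?_⟩
      · intro h0
        have h2 : AddMonoidAlgebra.single v0 (1:K) * (AddMonoidAlgebra.single (-v0) 1 * f) = 0 := by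
          rw [h0, mul_zero]
        rw [← mul_assoc, AddMonoidAlgebra.single_mul_single, add_neg_cancel, mul_one,
          ← AddMonoidAlgebra.one_def, one_mul] at h2
        exact hf0 h2
      · intro u hu
        obtain ⟨v, w, hv, hw, rfl⟩ := support_mul hu
        have hvv : v = -v0 := by
          by_contra hne
          rw [AddMonoidAlgebra.coeff_single, Finsupp.single_eq_of_ne hne] at hv
          exact hv rfl
        rw [hvv, Matrix.add_vecMul, Matrix.neg_vecMul, hcon w hw, neg_add_cancel]
    obtain ⟨v1, hv1, hv01⟩ := hv1
    set w0 := Matrix.vecMul v0 (N ^ j) with hw0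
    let f0 : LP K (Fin n) := AddMonoidAlgebra.ofCoeff (f.coeff.filter fun v => Matrix.vecMul v (N ^ j) = w0)
    let f' : LP K (Fin n) := AddMonoidAlgebra.ofCoeff (f.coeff.filter fun v => ¬ Matrix.vecMul v (N ^ j) = w0)
    have hff : f = f0 + f' := by
      apply AddMonoidAlgebra.coeff_injective
      exact (Finsupp.filter_add_filter_not f.coeff _).symm
    have hf0s : ∀ v, f0.coeff v ≠ 0 → f.coeff v ≠ 0 ∧ Matrix.vecMul v (N ^ j) = w0 := by
      intro v hv
      have := Finsupp.mem_support_iff.2 hv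
      change v ∈ (f.coeff.filter _).support at this
      rw [Finsupp.support_filter, Finset.mem_filter, Finsupp.mem_support_iff] at this
      exact this
    have hf's : ∀ v, f'.coeff v ≠ 0 → f.coeff v ≠ 0 ∧ Matrix.vecMul v (N ^ j) ≠ w0 := by
      intro v hv
      have := Finsupp.mem_support_iff.2 hv
      change v ∈ (f.coeff.filter _).support at this
      rw [Finsupp.support_filter, Finset.mem_filter, Finsupp.mem_support_iff] at this
      exact this
    have hf0ne : f0 ≠ 0 := by
      intro h
      have : f0.coeff v0 = f.coeff v0 := Finsupp.filter_apply_pos _ _ rfl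
      rw [h] at this
      exact hv0 this.symm
    have hf'ne : f' ≠ 0 := by
      intro h
      have : f'.coeff v1 = f.coeff v1 := Finsupp.filter_apply_pos _ _ hv01
      rw [h] at this
      exact hv1 this.symm
    set g := pb M a f' * f0 - f' * pb M a f0 with hg
    have hgI : g ∈ I := by
      have : g = pb M a f * f0 - f * pb M a f0 := by
        rw [hg, hff, map_add]; ring
      rw [this]
      exact I.sub_mem (I.mul_mem_right _ (hI f hfI)) (I.mul_mem_right _ hfI)
    have hgs : ∀ u, g.coeff u ≠ 0 → ∃ v w, f'.coeff v ≠ 0 ∧ f0.coeff w ≠ 0 ∧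
        (u = Matrix.vecMul v M + w ∨ u = v + Matrix.vecMul w M) := by
      intro u hu
      have : (pb M a f' * f0).coeff u ≠ 0 ∨ (f' * pb M a f0).coeff u ≠ 0 := by
        by_contra hcon
        push Not at hcon
        apply hu
        rw [hg, AddMonoidAlgebra.coeff_sub, Finsupp.sub_apply, hcon.1, hcon.2, sub_zero]
      rcases this with h | h
      · obtain ⟨v, w, hv, hw, rfl⟩ := support_mul h
        obtain ⟨v', hv', rfl⟩ := support_pb hinj a _ _ hv
        exact ⟨v', w, hv', hw, Or.inl rfl⟩
      · obtain ⟨v, w, hv, hw, rfl⟩ := support_mul h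
        obtain ⟨w', hw', rfl⟩ := support_pb hinj a _ _ hw
        exact ⟨v, w', hv, hw', Or.inr rfl⟩
    have hker : ∀ v, f.coeff v ≠ 0 → Matrix.vecMul (Matrix.vecMul v M) (N ^ j) = Matrix.vecMul v (N ^ j) := by
      intro v hv
      rw [hvM, hfs v hv, add_zero]
    have hker' : ∀ v, f.coeff v ≠ 0 → Matrix.vecMul (Matrix.vecMul v M) (N ^ (j+1)) = 0 := by
      intro v hv
      rw [hvM, hfs v hv, zero_add, pow_succ, ← Matrix.vecMul_vecMul, hfs v hv, Matrix.zero_vecMul]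
    have hgz : g = 0 := by
      apply hQmin g hgI
      · intro u hu
        obtain ⟨v, w, hv, hw, h | h⟩ := hgs u hu
        · rw [h, Matrix.add_vecMul, hker' v (hf's v hv).1, hfs w (hf0s w hw).1, add_zero]
        · rw [h, Matrix.add_vecMul, hker' w (hf0s w hw).1, hfs v (hf's v hv).1, add_zero]
      · have hw0m : w0 ∈ cl f := Finset.mem_image.2 ⟨v0, Finsupp.mem_support_iff.2 hv0, rfl⟩
        have hsub : cl g ⊆ ((cl f).erase w0).image fun w => w + w0 := by
          intro y hy
          obtain ⟨u, hu, rfl⟩ := Finset.mem_image.1 hy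
          obtain ⟨v, w, hv, hw, h⟩ := hgs u (Finsupp.mem_support_iff.1 hu)
          refine Finset.mem_image.2 ⟨Matrix.vecMul v (N ^ j), Finset.mem_erase.2 ⟨(hf's v hv).2,
            Finset.mem_image.2 ⟨v, Finsupp.mem_support_iff.2 (hf's v hv).1, rfl⟩⟩, ?_⟩
          rcases h with h | h
          · rw [h, Matrix.add_vecMul, hker v (hf's v hv).1, (hf0s w hw).2]
          · rw [h, Matrix.add_vecMul, hker w (hf0s w hw).1, (hf0s w hw).2]
        calc (cl g).card ≤ _ := Finset.card_le_card hsub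
          _ ≤ _ := Finset.card_image_le
          _ < _ := Finset.card_erase_lt_of_mem hw0m
    obtain ⟨p', hp'⟩ := exists_lead D f' hf'ne
    obtain ⟨p0, hp0⟩ := exists_lead D f0 hf0ne
    obtain ⟨hl1, hc1⟩ := lead_mul hD (lead_pb hinj hDM hD a hp') hp0
    obtain ⟨hl2, hc2⟩ := lead_mul hD hp' (lead_pb hinj hDM hD a hp0)
    have hgz' : pb M a f' * f0 = f' * pb M a f0 := sub_eq_zero.1 (hg ▸ hgz)
    rw [hgz'] at hl1 hc1
    have he := lead_unique hD hl1 hl2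
    rw [he, hc2, coeff_pb hinj, coeff_pb hinj] at hc1
    refine ⟨p' - p0, ?_, ?_, ?_⟩
    · intro h
      have h1 := (hf's p' hp'.1).2
      rw [sub_eq_zero.1 h] at h1
      exact h1 (hf0s p0 hp0.1).2
    · rw [Matrix.sub_vecMul, sub_eq_sub_iff_add_eq_add, he]
    · rw [chi_sub, div_eq_one]
      have hx := mul_ne_zero hp'.1 hp0.1
      apply Units.ext
      apply mul_left_cancel₀ hx
      linear_combination -hc1

theorem char_of_periodic [IsAlgClosed K] {M : Matrix (Fin n) (Fin n) ℤ} (hM : M.det ≠ 0) (k : ℕ)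
    (hN : (M - 1) ^ k = 0) (a : Fin n → Kˣ) (Z : Set (Fin n → Kˣ)) (hZ : Z ≠ Set.univ)
    (hZc : IsZariskiClosed Z) (hZn : Z.Nonempty) (hP : IsPeriodicSet (fun x => a * tE M x) Z) :
    ∃ v : Fin n → ℤ, v ≠ 0 ∧ Matrix.vecMul v M = v ∧ chi v a = 1 := by
  have : Infinite K := IsAlgClosed.instInfinite
  set Φ : (Fin n → Kˣ) → (Fin n → Kˣ) := fun x => a * tE M x with hΦ
  obtain ⟨T, hT, hTZ⟩ := hP
  obtain ⟨f, hf, hfZ⟩ := exists_ne_of_closed hZc hZ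
  have hsm : ∀ (m : ℕ) (x : Fin n → Kˣ), ev x ((pb M a)^[m] f) = ev (Φ^[m] x) f := by
    intro m
    induction m with
    | zero => simp
    | succ m ih =>
      intro x
      rw [Function.iterate_succ_apply', ev_pb, ih, Function.iterate_succ_apply]
  have hsurj : ∀ m : ℕ, ∃ x, ev x ((pb M a)^[m] f) ≠ 0 := by
    intro m
    have hs : Function.Surjective Φ := by
      intro x
      obtain ⟨y, hy⟩ := tE_surj M hM (x / a)
      exact ⟨y, by simp [hΦ, hy]⟩
    obtain ⟨x, hx⟩ := hf
    obtain ⟨y, rfl⟩ := hs.iterate m x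
    exact ⟨y, by rwa [hsm]⟩
  let I : Ideal (LP K (Fin n)) := ⨅ z ∈ Z, ⨅ j : ℕ, RingHom.ker (ev (Φ^[j] z))
  have hI : ∀ f, f ∈ I ↔ ∀ z ∈ Z, ∀ j : ℕ, ev (Φ^[j] z) f = 0 := by
    intro f
    simp [I, Submodule.mem_iInf, RingHom.mem_ker]
  refine core hM k hN a I ?_ ?_ ?_
  · intro f hf
    rw [hI] at hf ⊢
    intro z hz j
    have := hf z hz (j + 1)
    rw [Function.iterate_succ_apply'] at this
    rw [ev_pb]
    exact this
  · obtain ⟨x, hx⟩ := exists_ev_prod_ne (Finset.range T) (fun m => (pb M a)^[m] f)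
      (fun m _ => hsurj m)
    refine ⟨∏ m ∈ Finset.range T, (pb M a)^[m] f, (hI _).2 ?_, fun h => hx (by rw [h, map_zero])⟩
    intro z hz j
    rw [map_prod]
    apply Finset.prod_eq_zero (i := (T - j % T) % T) (Finset.mem_range.2 (Nat.mod_lt _ hT))
    rw [hsm, ← Function.iterate_add_apply]
    apply hfZ
    have hdvd : T ∣ (T - j % T) % T + j := by
      have h1 : j % T < T := Nat.mod_lt _ hT
      rw [Nat.dvd_iff_mod_eq_zero, Nat.add_mod, Nat.mod_mod, ← Nat.add_mod,
        Nat.add_mod, ← Nat.mod_mod j, ← Nat.add_mod, Nat.mod_mod, Nat.sub_add_cancel h1.le, Nat.mod_self]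
    obtain ⟨c, hc⟩ := hdvd
    rw [hc, Function.iterate_mul]
    have hmaps : Set.MapsTo (Φ^[T]) Z Z := by
      intro y hy; rw [← hTZ]; exact ⟨y, hy, rfl⟩
    exact hmaps.iterate c hz
  · intro htop
    obtain ⟨z, hz⟩ := hZn
    have := (hI 1).1 (htop ▸ Submodule.mem_top) z hz 0
    simp at this

end core
end TorDyn

set_option linter.unusedSectionVars false
set_option linter.unusedSimpArgs false
namespace TorDyn
open Polynomial

theorem prime_dvd_value (g : ℤ[X]) (hg : 1 ≤ g.natDegree) (m : ℤ) (hm : m ≠ 0) :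
    ∃ l : ℕ, l.Prime ∧ ¬ (l : ℤ) ∣ m ∧ ∃ k : ℤ, (l : ℤ) ∣ g.eval k := by
  by_cases h0 : g.eval 0 = 0
  · obtain ⟨l, hl, hp⟩ := Nat.exists_infinite_primes (m.natAbs + 1)
    refine ⟨l, hp, ?_, 0, by rw [h0]; exact dvd_zero _⟩
    intro h
    have := Nat.le_of_dvd (Int.natAbs_pos.2 hm) (Int.natCast_dvd.1 h)
    omega
  · have hfin : ∀ c : ℤ, {k : ℤ | g.eval k = c}.Finite := by
      intro c
      have hne : g - C c ≠ 0 := by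
        intro h
        have : g = C c := sub_eq_zero.1 h
        rw [this, natDegree_C] at hg
        omega
      refine ((g - C c).roots.toFinset.finite_toSet).subset ?_
      intro k hk
      simp only [Finset.mem_coe, Multiset.mem_toFinset, mem_roots hne, IsRoot, eval_sub, eval_C]
      exact sub_eq_zero.2 hk
    have hinj : Function.Injective (fun t : ℤ => g.eval 0 * m * t) := by
      intro s t h
      exact mul_left_cancel₀ (mul_ne_zero h0 hm) h
    have hinf := (Set.infinite_range_of_injective hinj)
    obtain ⟨k, ⟨t, rfl⟩, hk⟩ := (hinf.sdiff ((hfin (g.eval 0)).union (hfin (-g.eval 0)))).nonempty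
    simp only [Set.mem_union, Set.mem_ofPred_eq, not_or] at hk
    have hd : g.eval 0 * m * t - 0 ∣ g.eval (g.eval 0 * m * t) - g.eval 0 := g.sub_dvd_eval_sub _ _
    obtain ⟨w, hw⟩ := hd
    have he : g.eval (g.eval 0 * m * t) = g.eval 0 * (1 + m * (t * w)) := by
      linear_combination hw
    have h1 : (1 + m * (t * w)).natAbs ≠ 1 := by
      intro h
      rcases Int.natAbs_eq_natAbs_iff.1 (h.trans Int.natAbs_one.symm) with h | h
      · exact hk.1 (by rw [he, h, mul_one])
      · exact hk.2 (by rw [he, h]; ring)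
    obtain ⟨l, hl, hdv⟩ := Nat.exists_prime_and_dvd h1
    have hdv' := Int.natCast_dvd.2 hdv
    refine ⟨l, hl, ?_, g.eval 0 * m * t, ?_⟩
    · intro hlm
      have : (l : ℤ) ∣ 1 := (Int.dvd_add_left (Dvd.dvd.mul_right hlm _)).1 hdv'
      have := Int.natCast_dvd.1 this
      simp at this
      exact hl.one_lt.ne' this
    · rw [he]; exact Dvd.dvd.mul_left hdv' _

theorem exists_split_prime (q : ℤ[X]) (hq : q.Monic) (m : ℤ) (hm : m ≠ 0) :
    ∃ l : ℕ, l.Prime ∧ ¬ (l : ℤ) ∣ m ∧ (q.map (Int.castRingHom (ZMod l))).Splits := by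
  let F := (q.map (Int.castRingHom ℚ)).SplittingField
  obtain ⟨β, hβ⟩ := Field.exists_primitive_element ℚ F
  have halgβ : IsAlgebraic ℤ β :=
    (IsFractionRing.isAlgebraic_iff ℤ ℚ F).2 (Algebra.IsAlgebraic.isAlgebraic (R := ℚ) β)
  obtain ⟨y, hy, hint⟩ := halgβ.exists_integral_multiple
  set α : F := y • β with hα
  let A := Algebra.adjoin ℤ ({α} : Set F)
  have hα' : α ∈ A := Algebra.subset_adjoin (by simp)
  -- every element has an integral multiple in A
  have hmul : ∀ z : F, ∃ s : ℤ, s ≠ 0 ∧ s • z ∈ A := by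
    have hyF : (y : F) ≠ 0 := by exact_mod_cast hy
    have hyQ : (y : ℚ) ≠ 0 := by exact_mod_cast hy
    intro z
    have hz : z ∈ (IntermediateField.adjoin ℚ ({β} : Set F)) := by rw [hβ]; trivial
    have hz' : z ∈ Algebra.adjoin ℚ ({β} : Set F) := by
      rw [← IntermediateField.adjoin_simple_toSubalgebra_of_isAlgebraic
        (Algebra.IsAlgebraic.isAlgebraic (R := ℚ) β)]
      exact hz
    induction hz' using Algebra.adjoin_induction with
    | mem x hx =>
      rw [Set.mem_singleton_iff] at hx
      subst hx
      exact ⟨y, hy, hα'⟩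
    | algebraMap r =>
      refine ⟨r.den, by exact_mod_cast r.den_ne_zero, ?_⟩
      have : ((r.den : ℤ)) • (algebraMap ℚ F r) = algebraMap ℤ F r.num := by
        have h1 : (r.den : ℚ) * r = r.num := Rat.den_mul_eq_num r
        have h2 := congrArg (algebraMap ℚ F) h1
        rw [zsmul_eq_mul]
        rw [map_mul, map_natCast, map_intCast] at h2
        simpa using h2
      rw [this]
      exact A.algebraMap_mem _
    | add u v _ _ hu hv =>
      obtain ⟨s, hs, hs'⟩ := hu (by rw [hβ]; trivial)
      obtain ⟨t, ht, ht'⟩ := hv (by rw [hβ]; trivial)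
      refine ⟨s * t, mul_ne_zero hs ht, ?_⟩
      have : (s * t) • (u + v) = t • (s • u) + s • (t • v) := by
        simp only [zsmul_eq_mul]; push_cast; ring
      rw [this]
      exact A.add_mem (A.smul_mem hs' t) (A.smul_mem ht' s)
    | mul u v _ _ hu hv =>
      obtain ⟨s, hs, hs'⟩ := hu (by rw [hβ]; trivial)
      obtain ⟨t, ht, ht'⟩ := hv (by rw [hβ]; trivial)
      refine ⟨s * t, mul_ne_zero hs ht, ?_⟩
      have : (s * t) • (u * v) = (s • u) * (t • v) := by
        simp only [zsmul_eq_mul]; push_cast; ring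
      rw [this]
      exact A.mul_mem hs' ht'
  choose s hs hsA using hmul
  let t : F → A := fun z => ⟨s z • z, hsA z⟩
  let qF : F[X] := q.map (Int.castRingHom F)
  have hqFs : qF.Splits := by
    have := SplittingField.splits (q.map (Int.castRingHom ℚ))
    rw [Polynomial.map_map] at this
    convert this using 1
    rfl
  have hqFm : qF.Monic := hq.map _
  let u : ℤ := (qF.roots.map s).prod
  have hu : u ≠ 0 := by
    apply Multiset.prod_ne_zero
    intro h
    obtain ⟨z, _, hz⟩ := Multiset.mem_map.1 h
    exact hs z hz
  have hident : C ((u : ℤ) : A) * q.map (Int.castRingHom A) =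
      (qF.roots.map (fun r => C ((s r : ℤ) : A) * X - C (t r))).prod := by
    have hinj : Function.Injective (Polynomial.map (algebraMap A F)) :=
      Polynomial.map_injective _ Subtype.val_injective
    apply hinj
    rw [Polynomial.map_mul, Polynomial.map_map, map_C]
    have e1 : (algebraMap A F).comp (Int.castRingHom A) = Int.castRingHom F := RingHom.ext_int _ _
    rw [e1]
    change _ * qF = _
    conv_lhs => rw [hqFs.eq_prod_roots_of_monic hqFm]
    rw [Polynomial.map_multiset_prod, Multiset.map_map]
    have e2 : C (algebraMap A F ((u : ℤ) : A)) = (qF.roots.map (fun r => C ((s r : ℤ) : F))).prod := by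
      rw [map_intCast]
      simp only [u]
      generalize qF.roots = R
      induction R using Multiset.induction_on with
      | empty => simp
      | cons a R ih => simp at ih ⊢; rw [ih, Polynomial.C_eq_intCast]
    rw [e2, ← Multiset.prod_map_mul]
    congr 1
    apply Multiset.map_congr rfl
    intro r _
    simp only [Function.comp, Polynomial.map_sub, Polynomial.map_mul, map_C, map_X, map_intCast]
    have e3 : algebraMap A F (t r) = (s r : F) * r := by
      change s r • r = _
      rw [zsmul_eq_mul]
    rw [e3, mul_sub, C_mul, Polynomial.C_eq_intCast]
    simp
  have hdeg : 1 ≤ (minpoly ℤ α).natDegree := minpoly.natDegree_pos hint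
  obtain ⟨l, hl, hlm, k, hk⟩ := prime_dvd_value (minpoly ℤ α) hdeg (m * u) (mul_ne_zero hm hu)
  have := Fact.mk hl
  refine ⟨l, hl, fun h => hlm (Dvd.dvd.mul_right h _), ?_⟩
  let ψ0 : AdjoinRoot (minpoly ℤ α) →+* ZMod l := AdjoinRoot.lift (Int.castRingHom (ZMod l)) (k : ZMod l) (by
    have h9 := Polynomial.eval₂_at_apply (p := minpoly ℤ α) (Int.castRingHom (ZMod l)) k
    refine h9.trans ?_
    exact (ZMod.intCast_zmod_eq_zero_iff_dvd _ _).2 hk)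
  let ψ : A →+* ZMod l := ψ0.comp (minpoly.equivAdjoin hint).symm.toAlgHom.toRingHom
  have h1 := congrArg (Polynomial.map ψ) hident
  rw [Polynomial.map_mul, Polynomial.map_map, map_C, map_intCast] at h1
  have e4 : ψ.comp (Int.castRingHom A) = Int.castRingHom (ZMod l) := RingHom.ext_int _ _
  rw [e4] at h1
  have hu' : ((u : ℤ) : ZMod l) ≠ 0 := by
    intro h
    exact hlm (Dvd.dvd.mul_left ((ZMod.intCast_zmod_eq_zero_iff_dvd _ _).1 h) _)
  have hsp : (C ((u : ℤ) : ZMod l) * q.map (Int.castRingHom (ZMod l))).Splits := by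
    rw [h1, Polynomial.map_multiset_prod, Multiset.map_map]
    apply Splits.multisetProd
    intro f hf
    obtain ⟨r, _, rfl⟩ := Multiset.mem_map.1 hf
    apply Splits.of_natDegree_le_one
    simp only [Function.comp, Polynomial.map_sub, Polynomial.map_mul, map_C, map_X, map_intCast]
    compute_degree
  exact hsp.of_dvd (mul_ne_zero (C_ne_zero.2 hu') (hq.map _).ne_zero) (dvd_mul_left _ _)

end TorDyn

set_option linter.unusedSectionVars false
set_option linter.unusedSimpArgs false
namespace TorDyn
open Polynomial

theorem clear_denoms (p : ℚ[X]) : ∃ (c : ℤ) (p' : ℤ[X]), c ≠ 0 ∧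
    p'.map (Int.castRingHom ℚ) = C (c : ℚ) * p := by
  obtain ⟨b, hb, h⟩ := IsLocalization.integerNormalization_spec (nonZeroDivisors ℤ) p
  refine ⟨b, IsLocalization.integerNormalization (nonZeroDivisors ℤ) p, nonZeroDivisors.ne_zero hb, ?_⟩
  rw [← algebraMap_int_eq, h, zsmul_eq_mul, Polynomial.C_eq_intCast]

theorem int_bezout (q : ℤ[X]) (hsep : (q.map (Int.castRingHom ℚ)).Separable) :
    ∃ (c : ℤ) (A B : ℤ[X]), c ≠ 0 ∧ A * q + B * derivative q = C c := by
  obtain ⟨a, b, hab⟩ := hsep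
  obtain ⟨c, A, hc, hA⟩ := clear_denoms a
  obtain ⟨d, B, hd, hB⟩ := clear_denoms b
  refine ⟨c * d, C d * A, C c * B, mul_ne_zero hc hd, ?_⟩
  apply Polynomial.map_injective (Int.castRingHom ℚ) Int.cast_injective
  rw [derivative_map] at hab
  simp only [Polynomial.map_add, Polynomial.map_mul, map_C, hA, hB, C_mul]
  change C (d:ℚ) * _ * _ + C (c:ℚ) * _ * _ = C (c:ℚ) * C (d:ℚ)
  linear_combination (C (c:ℚ) * C (d:ℚ)) * hab

theorem good_prime {κ : Type*} [Fintype κ] [DecidableEq κ] (Cm : Matrix κ κ ℤ) (q : ℤ[X])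
    (hq : q.Monic) (hsep : (q.map (Int.castRingHom ℚ)).Separable) (h0 : q.coeff 0 ≠ 0)
    (hC : aeval Cm q = 0) (m : ℤ) (hm : m ≠ 0) :
    ∃ l : ℕ, l.Prime ∧ ¬ (l : ℤ) ∣ m ∧ ∀ e : ℕ, (l - 1) ∣ e → ∀ i j, (l : ℤ) ∣ (Cm ^ e - 1) i j := by
  obtain ⟨c, A, B, hc, hAB⟩ := int_bezout q hsep
  obtain ⟨l, hl, hlm, hsp⟩ := exists_split_prime q hq (m * c * q.coeff 0)
    (mul_ne_zero (mul_ne_zero hm hc) h0)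
  have := Fact.mk hl
  have hl1 : ¬ (l : ℤ) ∣ c := fun h => hlm ((Dvd.dvd.mul_left h _).mul_right _)
  have hl2 : ¬ (l : ℤ) ∣ q.coeff 0 := fun h => hlm (Dvd.dvd.mul_left h _)
  refine ⟨l, hl, fun h => hlm ((Dvd.dvd.mul_right h _).mul_right _), ?_⟩
  set φ := Int.castRingHom (ZMod l) with hφ
  have hφ0 : ∀ z : ℤ, φ z = 0 ↔ (l : ℤ) ∣ z := fun z => ZMod.intCast_zmod_eq_zero_iff_dvd _ _
  have hsep' : (q.map φ).Separable := by
    have h := congrArg (Polynomial.map φ) hAB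
    simp only [Polynomial.map_add, Polynomial.map_mul, map_C] at h
    have hcu : φ c ≠ 0 := fun h => hl1 ((hφ0 c).1 h)
    refine ⟨C (φ c)⁻¹ * A.map φ, C (φ c)⁻¹ * B.map φ, ?_⟩
    rw [derivative_map]
    have h5 : C (φ c)⁻¹ * C (φ c) = 1 := by rw [← C_mul, inv_mul_cancel₀ hcu, C_1]
    linear_combination C (φ c)⁻¹ * h + h5
  have hdvd : q.map φ ∣ X ^ l - X := by
    apply hsp.dvd_of_roots_le_roots (hq.map _).ne_zero
    have := FiniteField.roots_X_pow_card_sub_X (ZMod l)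
    rw [ZMod.card] at this
    rw [this, Multiset.le_iff_subset (nodup_roots hsep')]
    intro x _
    exact Finset.mem_univ x
  have hdvd' : q.map φ ∣ X ^ (l - 1) - 1 := by
    have hcop : IsCoprime (q.map φ) X := by
      have hu : φ (q.coeff 0) ≠ 0 := fun h => hl2 ((hφ0 _).1 h)
      have hX : X ∣ q.map φ - C (φ (q.coeff 0)) := by
        rw [X_dvd_iff]; simp
      obtain ⟨w, hw⟩ := hX
      have h5 : C (φ (q.coeff 0))⁻¹ * C (φ (q.coeff 0)) = 1 := by
        rw [← C_mul, inv_mul_cancel₀ hu, C_1]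
      exact ⟨C (φ (q.coeff 0))⁻¹, - C (φ (q.coeff 0))⁻¹ * w, by
        linear_combination C (φ (q.coeff 0))⁻¹ * hw + h5⟩
    apply hcop.dvd_of_dvd_mul_left
    have : X * (X ^ (l - 1) - 1 : (ZMod l)[X]) = X ^ l - X := by
      obtain ⟨k, rfl⟩ : ∃ k, l = k + 1 := ⟨l - 1, by have := hl.pos; omega⟩
      simp [pow_succ]; ring
    rwa [this]
  let Cb : Matrix κ κ (ZMod l) := φ.mapMatrix Cm
  have hCb : aeval Cb (q.map φ) = 0 := by
    have := congrArg φ.mapMatrix hC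
    rw [map_zero, aeval_def, hom_eval₂] at this
    rw [aeval_def, eval₂_map]
    have e9 : (algebraMap (ZMod l) (Matrix κ κ (ZMod l))).comp φ =
        (φ.mapMatrix (m := κ)).comp (algebraMap ℤ (Matrix κ κ ℤ)) := RingHom.ext_int _ _
    rw [e9]
    exact this
  have hpow : Cb ^ (l - 1) = 1 := by
    obtain ⟨w, hw⟩ := hdvd'
    have := congrArg (aeval Cb) hw
    rw [map_mul, hCb, zero_mul] at this
    simp at this
    exact sub_eq_zero.1 this
  rintro e ⟨d, rfl⟩ i j
  have h6 : φ.mapMatrix (Cm ^ ((l - 1) * d) - 1) = 0 := by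
    rw [map_sub, map_pow, map_one, pow_mul]
    change (Cb ^ (l - 1)) ^ d - 1 = 0
    rw [hpow, one_pow, sub_self]
  rw [← hφ0]
  exact congrFun (congrFun h6 i) j

theorem good_pair {κ : Type*} [Fintype κ] [DecidableEq κ] (Cm : Matrix κ κ ℤ) (q : ℤ[X])
    (hq : q.Monic) (hsep : (q.map (Int.castRingHom ℚ)).Separable) (h0 : q.coeff 0 ≠ 0)
    (hC : aeval Cm q = 0) (D : ℕ) :
    ∃ N e : ℕ, 1 ≤ e ∧ e * D < N ∧ ∀ i j, (N : ℤ) ∣ (Cm ^ e - 1) i j := by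
  have key : ∀ s : ℕ, ∃ N e : ℕ, 1 ≤ N ∧ 1 ≤ e ∧ 2 ^ s * e ≤ N ∧
      ∀ d i j, (N : ℤ) ∣ (Cm ^ (2 * e * d) - 1) i j := by
    intro s
    induction s with
    | zero => exact ⟨1, 1, le_rfl, le_rfl, le_rfl, fun d i j => by simp⟩
    | succ s ih =>
      obtain ⟨N, e, hN, he, hle, hdvd⟩ := ih
      obtain ⟨l, hl, hln, hle'⟩ := good_prime Cm q hq hsep h0 hC (2 * N) (by positivity)
      have hl2 : l ≠ 2 := by
        rintro rfl; exact hln ⟨N, by push_cast; ring⟩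
      obtain ⟨h, hh⟩ := hl.odd_of_ne_two hl2
      have hh1 : 1 ≤ h := by have := hl.two_le; omega
      refine ⟨N * l, e * h, ?_, ?_, ?_, ?_⟩
      · exact Nat.one_le_iff_ne_zero.2 (mul_ne_zero (by omega) hl.ne_zero)
      · exact Nat.one_le_iff_ne_zero.2 (mul_ne_zero (by omega) (by omega))
      · calc 2 ^ (s+1) * (e * h) = (2 ^ s * e) * (2 * h) := by ring
          _ ≤ N * l := Nat.mul_le_mul hle (by omega)
      · intro d i j
        push_cast
        apply IsCoprime.mul_dvd
        · have : Nat.Coprime N l := by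
            rw [Nat.coprime_comm, hl.coprime_iff_not_dvd]
            intro h7
            exact hln (Dvd.dvd.mul_left (Int.natCast_dvd_natCast.2 h7) _)
          exact Nat.isCoprime_iff_coprime.2 this
        · have := hdvd (h * d) i j
          rwa [show 2 * e * (h * d) = 2 * (e * h) * d by ring] at this
        · apply hle'
          exact ⟨e * d, by rw [hh]; simp; ring⟩
  obtain ⟨N, e, hN, he, hle, hd⟩ := key (2 * D)
  refine ⟨N, 2 * e, by omega, ?_, fun i j => by simpa using hd 1 i j⟩
  have : 2 * D < 2 ^ (2 * D) := Nat.lt_two_pow_self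
  calc 2 * e * D = 2 * D * e := by ring
    _ < 2 ^ (2 * D) * e := Nat.mul_lt_mul_of_pos_right this (by omega)
    _ ≤ N := hle

end TorDyn

set_option linter.unusedSectionVars false
set_option linter.unusedSimpArgs false
namespace TorDyn
section tors
variable {K : Type*} [Field K]

theorem torsion_pt [IsAlgClosed K] [CharZero K] {r : ℕ} (C : Matrix (Fin r) (Fin r) ℤ)
    (H : MvPolynomial (Fin r) K) (hH : H ≠ 0) (N e : ℕ) (he : 1 ≤ e) (hlt : e * H.totalDegree < N)
    (hC : ∀ i j, (N : ℤ) ∣ (C ^ e - 1) i j) :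
    ∃ z : Fin r → Kˣ, tE (C ^ e) z = z ∧
      ∀ m : ℕ, MvPolynomial.eval (fun i => (tE (C ^ m) z i : K)) H ≠ 0 := by
  classical
  have hN : N ≠ 0 := by omega
  have : NeZero N := ⟨hN⟩
  have : NeZero (N : K) := ⟨by exact_mod_cast hN⟩
  obtain ⟨ζ, hζ⟩ := HasEnoughRootsOfUnity.exists_primitiveRoot K N
  let S : Finset K := Polynomial.nthRootsFinset N (1 : K)
  have hScard : S.card = N := hζ.card_nthRootsFinset
  have : Fintype (rootsOfUnity N K) := Fintype.ofFinite _
  let U : Finset Kˣ := (Finset.univ : Finset (rootsOfUnity N K)).map ⟨Subtype.val, Subtype.val_injective⟩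
  have hU : ∀ u, u ∈ U ↔ u ^ N = 1 := by
    intro u; simp [U, mem_rootsOfUnity]
  have hUcard : U.card = N := by
    have h1 := hζ.card_rootsOfUnity
    rw [Finset.card_map, Finset.card_univ, ← Nat.card_eq_fintype_card]
    exact h1
  let P : Finset (Fin r → Kˣ) := Fintype.piFinset fun _ => U
  have hP : ∀ z, z ∈ P ↔ ∀ i, z i ^ N = 1 := by
    intro z; simp only [P, Fintype.mem_piFinset, hU]
  have hPcard : P.card = N ^ r := by
    simp [P, hUcard]
  have hPmap : ∀ (A : Matrix (Fin r) (Fin r) ℤ) z, z ∈ P → tE A z ∈ P := by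
    intro A z hz
    rw [hP] at hz ⊢
    have hz' : z ^ (N : ℤ) = 1 := by funext i; simpa using hz i
    intro i
    have := congrFun (tE_zpow (N : ℤ) A z) i
    rw [hz', tE_one_pt] at this
    simpa using this.symm
  have hfix : ∀ z ∈ P, tE (C ^ e) z = z := by
    intro z hz
    rw [hP] at hz
    have hz' : z ^ (N : ℤ) = 1 := by funext i; simpa using hz i
    choose E hE using hC
    have hCe : C ^ e = 1 + (N : ℤ) • (Matrix.of E) := by
      rw [← sub_eq_iff_eq_add']
      ext i j
      rw [hE]; simp
    rw [hCe, tE_add, tE_one, tE_smul, ← tE_zpow, hz', tE_one_pt, mul_one]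
  have hpe : ∀ k, ∀ z ∈ P, tE (C ^ (e * k)) z = z := by
    intro k z hz
    induction k with
    | zero => rw [mul_zero, pow_zero, tE_one]
    | succ k ih => rw [mul_add, mul_one, pow_add, tE_comp, hfix z hz, ih]
  let bad : ℕ → Finset (Fin r → Kˣ) := fun m =>
    P.filter fun z => MvPolynomial.eval (fun i => (tE (C ^ m) z i : K)) H = 0
  let Bd : Finset (Fin r → K) :=
    (Fintype.piFinset fun _ : Fin r => S).filter fun f => MvPolynomial.eval f H = 0
  have hinjm : ∀ m, ∀ z ∈ P, ∀ w ∈ P, tE (C ^ m) z = tE (C ^ m) w → z = w := by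
    intro m z hz w hw h
    have h2 := congrArg (tE (C ^ (e * m - m))) h
    have hle : m ≤ e * m := Nat.le_mul_of_pos_left m he
    rwa [← tE_comp, ← tE_comp, ← pow_add, Nat.sub_add_cancel hle, hpe m z hz, hpe m w hw] at h2
  have hbad : ∀ m, (bad m).card ≤ Bd.card := by
    intro m
    apply Finset.card_le_card_of_injOn (fun z i => (tE (C ^ m) z i : K))
    · intro z hz
      have hz' := Finset.mem_filter.1 (Finset.mem_coe.1 hz)
      refine Finset.mem_coe.2 (Finset.mem_filter.2 ⟨?_, hz'.2⟩)
      rw [Fintype.mem_piFinset]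
      intro i
      have := (hP _).1 (hPmap (C ^ m) z hz'.1) i
      rw [Polynomial.mem_nthRootsFinset (Nat.pos_of_ne_zero hN)]
      have h8 := congrArg Units.val this
      rw [Units.val_pow_eq_pow_val, Units.val_one] at h8
      exact h8
    · intro z hz w hw h
      have hz' := Finset.mem_filter.1 (Finset.mem_coe.1 hz)
      have hw' := Finset.mem_filter.1 (Finset.mem_coe.1 hw)
      apply hinjm m z hz'.1 w hw'.1
      funext i
      exact Units.ext (congrFun h i)
  have hSZ : Bd.card * N ≤ H.totalDegree * N ^ r := by
    have h := MvPolynomial.schwartz_zippel_totalDegree hH S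
    rw [hScard] at h
    have hNq : (0 : ℚ≥0) < N := by exact_mod_cast Nat.pos_of_ne_zero hN
    rw [div_le_div_iff₀ (by positivity) hNq] at h
    exact_mod_cast h
  have hex : ∃ z ∈ P, ∀ m < e, z ∉ bad m := by
    by_contra! hcon
    have hsub : P ⊆ (Finset.range e).biUnion bad := by
      intro z hz
      obtain ⟨m, hm, hmb⟩ := hcon z hz
      exact Finset.mem_biUnion.2 ⟨m, Finset.mem_range.2 hm, hmb⟩
    have h1 : N ^ r ≤ e * Bd.card := by
      rw [← hPcard]
      refine (Finset.card_le_card hsub).trans (Finset.card_biUnion_le.trans ?_)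
      refine (Finset.sum_le_sum fun m _ => hbad m).trans ?_
      simp
    have hpos : 0 < N ^ r := Nat.pos_of_ne_zero (pow_ne_zero _ hN)
    have h2 : N ^ r * N ≤ N ^ r * (e * H.totalDegree) := by
      calc N ^ r * N ≤ e * Bd.card * N := Nat.mul_le_mul_right _ h1
        _ = e * (Bd.card * N) := by ring
        _ ≤ e * (H.totalDegree * N ^ r) := Nat.mul_le_mul_left _ hSZ
        _ = _ := by ring
    have := Nat.le_of_mul_le_mul_left h2 hpos
    omega
  obtain ⟨z, hz, hzb⟩ := hex
  refine ⟨z, hfix z hz, fun m hm => ?_⟩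
  apply hzb (m % e) (Nat.mod_lt _ he)
  refine Finset.mem_filter.2 ⟨hz, ?_⟩
  have : tE (C ^ m) z = tE (C ^ (m % e)) z := by
    conv_lhs => rw [← Nat.mod_add_div m e, pow_add, tE_comp, hpe _ z hz]
  rwa [← this]

theorem B_of_quot [IsAlgClosed K] [CharZero K] {ι : Type*} [Fintype ι] [DecidableEq ι]
    {M : Matrix ι ι ℤ} (hM : M.det ≠ 0) {r : ℕ} (hr : 0 < r) {B : Matrix (Fin r) ι ℤ}
    {S : Matrix ι (Fin r) ℤ} {C : Matrix (Fin r) (Fin r) ℤ} (hBS : B * S = 1) (hBM : B * M = C * B)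
    (hC1 : (C - 1).det ≠ 0)
    (hgood : ∀ D : ℕ, ∃ N e : ℕ, 1 ≤ e ∧ e * D < N ∧ ∀ i j, (N : ℤ) ∣ (C ^ e - 1) i j)
    (a : ι → Kˣ) (Φ : (ι → Kˣ) → (ι → Kˣ)) (hΦ : Φ = fun x => a * tE M x) :
    ¬ ∃ Y : Set (ι → Kˣ), IsZariskiClosed Y ∧ Y ≠ Set.univ ∧
      ∀ Z : Set (ι → Kˣ), Z ≠ Set.univ → IsIrreducibleClosed Z →
        IsPeriodicSet Φ Z → ∃ m : ℕ, Φ^[m] '' Z ⊆ Y := by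
  have : Nonempty (Fin r) := ⟨⟨0, hr⟩⟩
  apply B_of_fib hM hBS hBM a Φ hΦ
  intro f ⟨x, hx⟩
  obtain ⟨y0, hy0⟩ := tE_surj (C - 1) hC1 (tE B a)⁻¹
  have hfixy : tE B a * tE C y0 = y0 := by
    rw [tE_sub, tE_one] at hy0
    have : tE C y0 = (tE B a)⁻¹ * y0 := div_eq_iff_eq_mul.1 hy0
    rw [this]; simp
  set k0 : ι → Kˣ := tE (1 - S * B) x with hk0
  have hBk : tE B k0 = 1 := by
    rw [hk0, ← tE_comp, Matrix.mul_sub, ← Matrix.mul_assoc, hBS, Matrix.mul_one, Matrix.one_mul,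
      sub_self, tE_zero]
  have hxk : k0 * tE S (tE B x) = x := by
    rw [hk0, tE_sub, tE_one, tE_comp]; simp
  obtain ⟨t, H, hH⟩ := exists_poly (pb (1 : Matrix (Fin r) (Fin r) ℤ) y0 (pb S k0 f))
  have hH' : ∀ z, MvPolynomial.eval (fun i => (z i : K)) H =
      (∏ i, (z i : K)) ^ t * ev (k0 * tE S (y0 * z)) f := by
    intro z; rw [hH, ev_pb, ev_pb, tE_one]
  have hH0 : H ≠ 0 := by
    rintro rfl
    have h1 := hH' (y0⁻¹ * tE B x)
    rw [map_zero, mul_inv_cancel_left, hxk] at h1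
    exact mul_ne_zero (pow_ne_zero _ (prod_units_ne _)) hx h1.symm
  obtain ⟨N, e, he, hlt, hdv⟩ := hgood H.totalDegree
  obtain ⟨z, hz1, hz2⟩ := torsion_pt C H hH0 N e he hlt hdv
  have hit : ∀ m : ℕ, (fun y => tE B a * tE C y)^[m] (y0 * z) = y0 * tE (C ^ m) z := by
    intro m
    induction m with
    | zero => simp [tE_one]
    | succ m ih =>
      rw [Function.iterate_succ_apply', ih, tE_mul, ← mul_assoc, hfixy, ← tE_comp, ← pow_succ']
  refine ⟨y0 * z, e, he, ?_, fun m => ?_⟩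
  · rw [hit, hz1]
  · rw [hit]
    refine ⟨k0 * tE S (y0 * tE (C ^ m) z), ?_, ?_⟩
    · rw [tE_mul, hBk, one_mul, ← tE_comp, hBS, tE_one]
    · have := hz2 m
      rw [hH'] at this
      exact right_ne_zero_of_mul this

end tors
end TorDyn

set_option linter.unusedSectionVars false
set_option linter.unusedSimpArgs false
namespace TorDyn
open Polynomial

theorem exists_factor {n : ℕ} (M : Matrix (Fin n) (Fin n) ℤ) (hM : M.det ≠ 0)
    (hnil : ∀ k : ℕ, (M - 1) ^ k ≠ 0) :
    ∃ q : ℤ[X], q.Monic ∧ (q.map (Int.castRingHom ℚ)).Separable ∧ q.coeff 0 ≠ 0 ∧ q.eval 1 ≠ 0 ∧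
      (aeval M q).det = 0 := by
  let Mc : Matrix (Fin n) (Fin n) ℂ := (Int.castRingHom ℂ).mapMatrix M
  have hcp : Mc.charpoly = M.charpoly.map (Int.castRingHom ℂ) := Matrix.charpoly_map M _
  have hroot : ∃ z ∈ Mc.charpoly.roots, z ≠ 1 := by
    by_contra! hcon
    have hs := IsAlgClosed.splits Mc.charpoly
    have h1 := hs.eq_prod_roots_of_monic (Matrix.charpoly_monic Mc)
    rw [Multiset.eq_replicate_of_mem hcon, Multiset.map_replicate, Multiset.prod_replicate] at h1
    generalize Multiset.card Mc.charpoly.roots = d at h1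
    have h2 : M.charpoly = (X - C 1) ^ d := by
      apply Polynomial.map_injective (Int.castRingHom ℂ) Int.cast_injective
      rw [← hcp, h1]
      simp
    have h3 := Matrix.aeval_self_charpoly M
    rw [h2] at h3
    simp at h3
    exact hnil _ h3
  obtain ⟨z, hz, hz1⟩ := hroot
  have hzr : Mc.charpoly.eval z = 0 := (mem_roots'.1 hz).2
  have hint : IsIntegral ℤ z := by
    refine ⟨M.charpoly, Matrix.charpoly_monic M, ?_⟩
    rw [← eval_map]
    rw [hcp] at hzr
    exact hzr
  have hdetz : (Matrix.scalar (Fin n) z - Mc).det = 0 := by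
    rw [← Matrix.eval_charpoly]; exact hzr
  have hMc : Mc.det = ((M.det : ℤ) : ℂ) := ((Int.castRingHom ℂ).map_det M).symm
  have hz0 : z ≠ 0 := by
    rintro rfl
    rw [map_zero, zero_sub, Matrix.det_neg, hMc] at hdetz
    have : ((M.det : ℤ) : ℂ) ≠ 0 := by exact_mod_cast hM
    exact mul_ne_zero (pow_ne_zero _ (by norm_num)) this hdetz
  have hq := minpoly.isIntegrallyClosed_eq_field_fractions' ℚ hint
  have hintQ : IsIntegral ℚ z := hint.tower_top
  refine ⟨minpoly ℤ z, minpoly.monic hint, ?_, ?_, ?_, ?_⟩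
  · rw [← algebraMap_int_eq, ← hq]
    exact (minpoly.irreducible hintQ).separable
  · intro h
    have h1 := minpoly.coeff_zero_ne_zero hintQ hz0
    apply h1
    rw [hq, coeff_map, h, map_zero]
  · intro h
    have h1 : IsRoot (minpoly ℚ z) 1 := by
      rw [IsRoot, hq, eval_map, eval₂_at_one, h, map_zero]
    have := minpoly.root hintQ h1
    rw [map_one] at this
    exact hz1 this.symm
  · have h1 : (aeval Mc ((minpoly ℤ z).map (Int.castRingHom ℂ))).det = 0 := by
      have hr : IsRoot ((minpoly ℤ z).map (Int.castRingHom ℂ)) z := by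
        rw [IsRoot, eval_map]
        exact minpoly.aeval ℤ z
      obtain ⟨w, hw⟩ := dvd_iff_isRoot.2 hr
      rw [hw, map_mul, Matrix.det_mul]
      have : aeval Mc (X - C z) = - (Matrix.scalar (Fin n) z - Mc) := by
        simp [Matrix.algebraMap_eq_diagonal]
      rw [this, Matrix.det_neg, hdetz, mul_zero, zero_mul]
    have h2 : aeval Mc ((minpoly ℤ z).map (Int.castRingHom ℂ)) =
        (Int.castRingHom ℂ).mapMatrix (aeval M (minpoly ℤ z)) := by
      have e9 : (algebraMap ℂ (Matrix (Fin n) (Fin n) ℂ)).comp (Int.castRingHom ℂ) =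
        ((Int.castRingHom ℂ).mapMatrix (m := Fin n)).comp (algebraMap ℤ (Matrix (Fin n) (Fin n) ℤ)) :=
        RingHom.ext_int _ _
      rw [aeval_def, eval₂_map, e9, aeval_def, hom_eval₂]
    rw [h2, ← RingHom.map_det] at h1
    exact Int.cast_injective (h1.trans Int.cast_zero.symm)

theorem exists_quot {n : ℕ} (M Q : Matrix (Fin n) (Fin n) ℤ) (hQ : Q.det = 0) (hc : M * Q = Q * M) :
    ∃ (r : ℕ) (B : Matrix (Fin r) (Fin n) ℤ) (S : Matrix (Fin n) (Fin r) ℤ)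
      (C : Matrix (Fin r) (Fin r) ℤ), 0 < r ∧ B * S = 1 ∧ B * M = C * B ∧ B * Q = 0 := by
  let L : (Fin n → ℤ) →ₗ[ℤ] (Fin n → ℤ) := Q.vecMulLinear
  have hL : ∀ v, L v = Matrix.vecMul v Q := fun v => rfl
  let W := LinearMap.ker L
  have hW : ∀ v, v ∈ W ↔ Matrix.vecMul v Q = 0 := fun v => LinearMap.mem_ker
  obtain ⟨v0, hv0, hv0Q⟩ := Matrix.exists_vecMul_eq_zero_iff.2 hQ
  let b := Module.finBasis ℤ W
  set r := Module.finrank ℤ W with hr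
  have hrpos : 0 < r := by
    rw [hr]
    have : Nontrivial W := ⟨⟨⟨v0, (hW _).2 hv0Q⟩, 0, fun h => hv0 (congrArg Subtype.val h)⟩⟩
    exact Module.finrank_pos
  obtain ⟨s, hs⟩ := Module.projective_lifting_property L.rangeRestrict LinearMap.id
    (LinearMap.surjective_rangeRestrict L)
  have hs' : ∀ v, L (s (L.rangeRestrict v)) = L v := by
    intro v
    have := LinearMap.congr_fun hs (L.rangeRestrict v)
    exact congrArg Subtype.val this
  let P : (Fin n → ℤ) →ₗ[ℤ] W :=
    LinearMap.codRestrict W (LinearMap.id - s.comp L.rangeRestrict) (by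
      intro v
      rw [LinearMap.mem_ker]
      simp only [LinearMap.sub_apply, LinearMap.id_apply, LinearMap.comp_apply, map_sub]
      rw [hs', sub_self])
  have hP : ∀ w : W, P w = w := by
    intro w
    apply Subtype.ext
    have h0 : L.rangeRestrict (w : Fin n → ℤ) = 0 := by
      apply Subtype.ext
      exact w.2
    simp [P, h0]
  have hWM : ∀ w : W, Matrix.vecMul (w : Fin n → ℤ) M ∈ W := by
    intro w
    rw [hW, Matrix.vecMul_vecMul, hc, ← Matrix.vecMul_vecMul, (hW _).1 w.2, Matrix.zero_vecMul]
  refine ⟨r, Matrix.of fun i => (b i : Fin n → ℤ),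
    Matrix.of fun j i => b.repr (P (Pi.single j 1)) i,
    Matrix.of fun i k => b.repr ⟨_, hWM (b i)⟩ k, hrpos, ?_, ?_, ?_⟩
  · ext i k
    have h1 : P (b i : Fin n → ℤ) = ∑ j, (b i : Fin n → ℤ) j • P (Pi.single j 1) := by
      conv_lhs => rw [pi_eq_sum_univ' (b i : Fin n → ℤ)]
      rw [map_sum]
      exact Finset.sum_congr rfl fun j _ => map_smul P _ _
    have h2 := congrArg (fun w => b.repr w k) h1
    simp only [hP, map_sum, map_smul, Finsupp.coe_finsetSum, Finset.sum_apply, Finsupp.smul_apply,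
      smul_eq_mul, b.repr_self] at h2
    rw [Matrix.mul_apply]
    simp only [Matrix.of_apply]
    rw [← h2, Finsupp.single_apply, Matrix.one_apply]
  · ext i j
    have h1 := congrArg (fun w : W => (w : Fin n → ℤ) j) (b.sum_repr ⟨_, hWM (b i)⟩)
    simp only [Submodule.coe_sum, Finset.sum_apply, Submodule.coe_smul, Pi.smul_apply, smul_eq_mul] at h1
    rw [Matrix.mul_apply (M := Matrix.of fun i k => b.repr ⟨_, hWM (b i)⟩ k)]
    simp only [Matrix.of_apply]
    rw [h1]
    rfl
  · ext i j
    exact congrFun ((hW _).1 (b i).2) j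

theorem case_two {K : Type*} [Field K] [IsAlgClosed K] [CharZero K] {n : ℕ}
    (M : Matrix (Fin n) (Fin n) ℤ) (hM : M.det ≠ 0) (hnil : ∀ k : ℕ, (M - 1) ^ k ≠ 0)
    (a : Fin n → Kˣ) (Φ : (Fin n → Kˣ) → (Fin n → Kˣ)) (hΦ : Φ = fun x => a * tE M x) :
    ¬ ∃ Y : Set (Fin n → Kˣ), IsZariskiClosed Y ∧ Y ≠ Set.univ ∧
      ∀ Z : Set (Fin n → Kˣ), Z ≠ Set.univ → IsIrreducibleClosed Z →
        IsPeriodicSet Φ Z → ∃ m : ℕ, Φ^[m] '' Z ⊆ Y := by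
  obtain ⟨q, hq, hsep, hq0, hq1, hdet⟩ := exists_factor M hM hnil
  have hcomm : M * aeval M q = aeval M q * M := by
    have h := congrArg (aeval M) (mul_comm X q)
    simpa using h
  obtain ⟨r, B, S, Cm, hr, hBS, hBM, hBQ⟩ := exists_quot M (aeval M q) hdet hcomm
  have hpol : ∀ p : ℤ[X], B * aeval M p = aeval Cm p * B := by
    intro p
    induction p using Polynomial.induction_on' with
    | add p p' h h' => rw [map_add, map_add, Matrix.mul_add, Matrix.add_mul, h, h']
    | monomial k c =>
      rw [aeval_monomial, aeval_monomial]
      have hk : B * M ^ k = Cm ^ k * B := by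
        induction k with
        | zero => simp
        | succ k ih => rw [pow_succ, ← Matrix.mul_assoc, ih, Matrix.mul_assoc, hBM, pow_succ,
            Matrix.mul_assoc]
      simp only [← Algebra.smul_def]
      rw [Matrix.mul_smul, hk, Matrix.smul_mul]
  have hC0 : aeval Cm q = 0 := by
    have h := hpol q
    rw [hBQ] at h
    calc aeval Cm q = aeval Cm q * (B * S) := by rw [hBS, Matrix.mul_one]
      _ = 0 := by rw [← Matrix.mul_assoc, ← h, Matrix.zero_mul]
  have hC1 : (Cm - 1).det ≠ 0 := by
    intro h
    have hr1 : IsRoot (q - C (q.eval 1)) 1 := by simp [IsRoot]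
    obtain ⟨w, hw⟩ := dvd_iff_isRoot.2 hr1
    have h2 := congrArg (fun p => (aeval Cm p).det) hw
    simp only [map_sub, map_mul, hC0, aeval_X, aeval_C, map_one, zero_sub, Matrix.det_mul, h,
      zero_mul, Matrix.det_neg] at h2
    rw [Algebra.algebraMap_eq_smul_one, Matrix.det_smul, Matrix.det_one, mul_one] at h2
    exact mul_ne_zero (pow_ne_zero _ (by norm_num)) (pow_ne_zero _ hq1) h2
  exact B_of_quot hM hr hBS hBM hC1 (good_pair Cm q hq hsep hq0 hC0) a Φ hΦ

end TorDyn

theorem dichotomy_for_translated_torus_endomorphisms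
    (K : Type*) [Field K] [IsAlgClosed K] [CharZero K]
    (n : ℕ) (hn : 1 ≤ n) (M : Matrix (Fin n) (Fin n) ℤ) (hM : M.det ≠ 0)
    (a : Fin n → Kˣ) (Φ : (Fin n → Kˣ) → (Fin n → Kˣ))
    (hΦ : ∀ x, Φ x = a * torusEndo M x) :
    (∃ X : Set (Fin n → Kˣ), IsZariskiClosed X ∧ X ≠ Set.univ ∧
      ∀ Z : Set (Fin n → Kˣ), Z ≠ Set.univ → IsIrreducibleClosed Z →
        IsPeriodicSet Φ Z → Z ⊆ X) ∨
    (¬ ∃ Y : Set (Fin n → Kˣ), IsZariskiClosed Y ∧ Y ≠ Set.univ ∧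
      ∀ Z : Set (Fin n → Kˣ), Z ≠ Set.univ → IsIrreducibleClosed Z →
        IsPeriodicSet Φ Z → ∃ m : ℕ, Φ^[m] '' Z ⊆ Y) := by
  have hΦ' : Φ = fun x => a * TorDyn.tE M x := funext hΦ
  by_cases hnil : ∃ k : ℕ, (M - 1) ^ k = 0
  · obtain ⟨k, hk⟩ := hnil
    by_cases hv : ∃ v : Fin n → ℤ, v ≠ 0 ∧ Matrix.vecMul v M = v ∧ TorDyn.chi v a = 1
    · obtain ⟨v, hv0, hvM, hva⟩ := hv
      exact Or.inr (TorDyn.B_of_char hM a Φ hΦ' v hv0 hvM hva)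
    · left
      refine ⟨∅, ⟨{1}, ?_⟩, ?_, ?_⟩
      · ext x
        simp
      · intro h
        exact Set.notMem_empty (1 : Fin n → Kˣ) (h ▸ Set.mem_univ _)
      · intro Z hZ hZi hZp
        rw [hΦ'] at hZp
        exact absurd (TorDyn.char_of_periodic hM k hk a Z hZ hZi.2.1 hZi.1 hZp) hv
  · push Not at hnil
    exact Or.inr (TorDyn.case_two M hM hnil a Φ hΦ')
end
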